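/- arXiv:math/0205077 — 3 statements merged into one kernel-verified Lean document; each statement's English description precedes it below -/
import Mathlib

section
/- Let μ be a compactly supported Borel probability measure on ℂ. For each n ≥ 1, let the joint law of (D_n, T_n) be given as follows: D_n = diag(d₁,…,d_n) is a diagonal random matrix whose diagonal entries are i.i.d. with law μ, T_n is a strictly upper triangular random matrix with law GT(n), and D_n and T_n are independent (so the joint law is the image of μ^{⊗n} ⊗ GT(n)). Then the pair (D_n, T_n) converges jointly in *-moments as n → ∞: for every m ≥ 1 and every word w : {1,…,m} → {D, D*, T, T*}, the sequence n ↦ E[tr_n(W₁·W₂·⋯·W_m)], where W_j is D_n, D_n*, T_n or T_n* according to w(j), converges to a limit in ℂ. -/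
open MeasureTheory ProbabilityTheory Matrix
open scoped ENNReal NNReal

/-- The complex Gaussian measure `N_ℂ(0,v)`: the pushforward of `N(0,v/2) × N(0,v/2)` under
`(x,y) ↦ x + iy`. -/
noncomputable def complexGaussian (v : ℝ≥0) : Measure ℂ :=
  ((gaussianReal 0 (v / 2)).prod (gaussianReal 0 (v / 2))).map
    fun p => (p.1 : ℂ) + (p.2 : ℂ) * Complex.I

/-- The law `GT(n)` of a strictly upper triangular `n×n` random matrix with i.i.d. complex
Gaussian `N_ℂ(0,1/n)` entries above the diagonal (and zeros elsewhere). -/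
noncomputable def GTlaw (n : ℕ) : Measure (Fin n → Fin n → ℂ) :=
  Measure.pi fun i => Measure.pi fun j =>
    if (i : ℕ) < (j : ℕ) then complexGaussian ((n : ℝ≥0))⁻¹ else Measure.dirac 0

/-- Letters of a `*`-word in `D` and `T`. -/
inductive Letter : Type
  | D : Letter
  | Dstar : Letter
  | T : Letter
  | Tstar : Letter

/-- Interpretation of a letter, given the diagonal `d` and the matrix `t`. -/
noncomputable def interp {n : ℕ} (d : Fin n → ℂ) (t : Matrix (Fin n) (Fin n) ℂ) :
    Letter → Matrix (Fin n) (Fin n) ℂ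
  | Letter.D => Matrix.diagonal d
  | Letter.Dstar => (Matrix.diagonal d)ᴴ
  | Letter.T => t
  | Letter.Tstar => tᴴ

def tauL : Letter → ℕ
  | Letter.D => 0
  | Letter.Dstar => 0
  | Letter.T => 1
  | Letter.Tstar => 1

noncomputable def cL {α : Type*} [DecidableEq α] : Letter → α → α → ℂ
  | Letter.D, a, b => if a = b then 1 else 0
  | Letter.Dstar, a, b => if a = b then 1 else 0
  | Letter.T, _, _ => 1
  | Letter.Tstar, _, _ => 1

noncomputable def fD : Letter → ℂ → ℂ
  | Letter.D, z => z
  | Letter.Dstar, z => star z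
  | Letter.T, _ => 1
  | Letter.Tstar, _ => 1

noncomputable def fT : Letter → ℂ → ℂ
  | Letter.D, _ => 1
  | Letter.Dstar, _ => 1
  | Letter.T, z => z
  | Letter.Tstar, z => star z

def posL {α : Type*} : Letter → α → α → α × α
  | Letter.D, a, b => (a, b)
  | Letter.Dstar, a, b => (a, b)
  | Letter.T, a, b => (a, b)
  | Letter.Tstar, a, b => (b, a)

noncomputable def entM (γ : Measure ℂ) {n : ℕ} (x : Fin n × Fin n) : Measure ℂ :=
  if (x.1 : ℕ) < (x.2 : ℕ) then γ else Measure.dirac 0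

noncomputable def Fm {m n : ℕ} (μ : Measure ℂ) (w : Fin m → Letter) (γ : Measure ℂ)
    (i : Fin (m + 1) → Fin n) : ℂ :=
  ((if i 0 = i (Fin.last m) then 1 else 0) * ∏ j, cL (w j) (i j.castSucc) (i j.succ)) *
  ((∏ a, ∫ z, ∏ j, (if i j.castSucc = a then fD (w j) z else 1) ∂μ) *
  ∏ x : Fin n × Fin n,
    ∫ z, ∏ j, (if posL (w j) (i j.castSucc) (i j.succ) = x then fT (w j) z else 1) ∂(entM γ x))

lemma interp_apply {n : ℕ} (d : Fin n → ℂ) (t : Fin n → Fin n → ℂ) (l : Letter) (a b : Fin n) :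
    interp d (Matrix.of t) l a b =
      cL l a b * (fD l (d a) * fT l (t (posL l a b).1 (posL l a b).2)) := by
  cases l
  · by_cases h : a = b <;> simp [interp, cL, fD, fT, h]
  · by_cases h : a = b
    · simp [interp, cL, fD, fT, h]
    · simp [interp, cL, fD, fT, h, Ne.symm h]
  · simp [interp, cL, fD, fT, posL]
  · simp [interp, cL, fD, fT, posL]

lemma path_prod {n : ℕ} : ∀ (m : ℕ) (W : Fin m → Matrix (Fin n) (Fin n) ℂ) (a b : Fin n),
    (List.ofFn W).prod a b = ∑ i : Fin (m + 1) → Fin n,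
      if i 0 = a ∧ i (Fin.last m) = b then ∏ j, W j (i j.castSucc) (i j.succ) else 0 := by
  intro m
  induction m with
  | zero =>
    intro W a b
    rw [← (Equiv.funUnique (Fin 1) (Fin n)).symm.sum_comp]
    simp [Matrix.one_apply]
    by_cases h : a = b
    · subst h; simp [Finset.filter_eq']
    · rw [if_neg h]
      symm
      rw [Nat.cast_eq_zero, Finset.card_eq_zero, Finset.filter_eq_empty_iff]
      rintro x _ ⟨rfl, h2⟩; exact h h2
  | succ m ih =>
    intro W a b
    rw [List.ofFn_succ, List.prod_cons, Matrix.mul_apply]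
    simp_rw [ih]
    rw [← (Fin.consEquiv (fun _ => Fin n)).sum_comp, Fintype.sum_prod_type]
    symm
    rw [Finset.sum_eq_single a]
    · symm
      simp_rw [Finset.mul_sum]
      rw [Finset.sum_comm]
      apply Finset.sum_congr rfl
      intro i _
      rw [Finset.sum_eq_single (i 0)]
      · simp only [Fin.consEquiv, Equiv.coe_fn_mk, Fin.cons_zero, true_and, Fin.prod_univ_succ]
        rw [← Fin.succ_last]
        simp only [Fin.cons_succ, Fin.castSucc_zero, Fin.cons_zero, ← Fin.succ_castSucc, mul_ite, mul_zero]
      · intro x _ hx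
        rw [if_neg, mul_zero]
        rintro ⟨h, -⟩; exact hx h.symm
      · simp
    · intro x _ hx
      apply Finset.sum_eq_zero
      intro i _
      rw [if_neg]
      simp [Fin.consEquiv, hx]
    · simp

lemma trace_path {n m : ℕ} (W : Fin m → Matrix (Fin n) (Fin n) ℂ) :
    (List.ofFn W).prod.trace = ∑ i : Fin (m + 1) → Fin n,
      (if i 0 = i (Fin.last m) then 1 else 0) * ∏ j, W j (i j.castSucc) (i j.succ) := by
  simp only [Matrix.trace, Matrix.diag, path_prod]
  rw [Finset.sum_comm]
  apply Finset.sum_congr rfl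
  intro i _
  rw [Finset.sum_eq_single (i 0)]
  · simp [eq_comm]
  · intro x _ hx
    rw [if_neg]
    rintro ⟨h, -⟩; exact hx h.symm
  · simp

lemma prod_regroup {ι κ : Type*} [Fintype ι] [Fintype κ] [DecidableEq κ] (p : ι → κ)
    (f : ι → ℂ → ℂ) (d : κ → ℂ) :
    ∏ j, f j (d (p j)) = ∏ a, ∏ j, (if p j = a then f j (d a) else 1) := by
  rw [Finset.prod_comm]
  apply Finset.prod_congr rfl
  intro j _
  simp

lemma walk_card {α : Type*} [DecidableEq α] : ∀ (m : ℕ) (v : Fin (m + 1) → α) (w : Fin m → Letter)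
    (_ : ∀ j, tauL (w j) = 0 → v j.castSucc = v j.succ),
    (Finset.univ.image v).card ≤ 1 + ((Finset.univ.filter fun j => tauL (w j) = 1).image
      fun j => posL (w j) (v j.castSucc) (v j.succ)).card := by
  intro m
  induction m with
  | zero =>
    intro v w _
    refine (Finset.card_image_le).trans ?_
    simp
  | succ m ih =>
    intro v w h
    have ih' := ih (fun j => v j.castSucc) (fun j => w j.castSucc) (fun j hj => h _ hj)
    set A := Finset.univ.image (fun j : Fin (m+1) => v j.castSucc) with hA
    set B := ((Finset.univ.filter fun j : Fin m => tauL (w j.castSucc) = 1).image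
      fun j : Fin m => posL (w j.castSucc) (v j.castSucc.castSucc) (v j.succ.castSucc)) with hB
    set B' := ((Finset.univ.filter fun j => tauL (w j) = 1).image
      fun j => posL (w j) (v j.castSucc) (v j.succ)) with hB'
    have hsub : Finset.univ.image v ⊆ insert (v (Fin.last _)) A := by
      intro x hx
      obtain ⟨j, -, rfl⟩ := Finset.mem_image.1 hx
      induction j using Fin.lastCases with
      | last => simp
      | cast j => exact Finset.mem_insert_of_mem (Finset.mem_image_of_mem (fun j : Fin (m+1) => v j.castSucc) (Finset.mem_univ j))
    have hBB : B ⊆ B' := by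
      intro x hx
      obtain ⟨j, hj, rfl⟩ := Finset.mem_image.1 hx
      refine Finset.mem_image.2 ⟨j.castSucc, by simpa using hj, ?_⟩
      rw [Fin.succ_castSucc]
    have h1 := Finset.card_le_card hsub
    have h2 := Finset.card_le_card hBB
    by_cases hv : v (Fin.last _) ∈ A
    · rw [Finset.insert_eq_of_mem hv] at h1
      omega
    · rw [Finset.card_insert_of_notMem hv] at h1
      have hT : tauL (w (Fin.last m)) = 1 := by
        by_contra hne
        have h0 : tauL (w (Fin.last m)) = 0 := by
          revert hne; cases w (Fin.last m) <;> simp [tauL]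
        have := h _ h0
        apply hv
        rw [← Fin.succ_last, ← this]
        exact Finset.mem_image_of_mem (fun j : Fin (m+1) => v j.castSucc) (Finset.mem_univ _)
      have hmem : posL (w (Fin.last m)) (v (Fin.last m).castSucc) (v (Fin.last m).succ) ∈ B' :=
        Finset.mem_image.2 ⟨Fin.last m, by simpa using hT, rfl⟩
      have hnot : posL (w (Fin.last m)) (v (Fin.last m).castSucc) (v (Fin.last m).succ) ∉ B := by
        intro hx
        obtain ⟨j, -, hj⟩ := Finset.mem_image.1 hx
        apply hv
        have m1 : v j.castSucc.castSucc ∈ A := Finset.mem_image_of_mem (fun j : Fin (m+1) => v j.castSucc) (Finset.mem_univ _)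
        have m2 : v j.succ.castSucc ∈ A := Finset.mem_image_of_mem (fun j : Fin (m+1) => v j.castSucc) (Finset.mem_univ _)
        rw [← Fin.succ_last]
        revert hj
        cases w j.castSucc <;> cases w (Fin.last m) <;> simp only [posL, Prod.mk.injEq] <;> grind
      have h3 := Finset.card_le_card (Finset.insert_subset hmem hBB)
      rw [Finset.card_insert_of_notMem hnot] at h3
      omega

def Mom (ν : Measure ℂ) : Prop := ∀ p : ℕ, Integrable (fun z : ℂ => (1 + ‖z‖) ^ p) ν

lemma continuous_fD (l : Letter) : Continuous (fD l) := by
  cases l <;> unfold fD <;> fun_prop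

lemma continuous_fT (l : Letter) : Continuous (fT l) := by
  cases l <;> unfold fT <;> fun_prop

lemma norm_fD (l : Letter) (z : ℂ) : ‖fD l z‖ ≤ 1 + ‖z‖ := by
  cases l <;> simp [fD]

lemma norm_fT (l : Letter) (z : ℂ) : ‖fT l z‖ ≤ 1 + ‖z‖ := by
  cases l <;> simp [fT]

lemma mom_int {ν : Measure ℂ} (h : Mom ν) {m : ℕ} (P : Fin m → Prop) [DecidablePred P]
    (f : Fin m → ℂ → ℂ) (hc : ∀ j, Continuous (f j)) (hn : ∀ j z, ‖f j z‖ ≤ 1 + ‖z‖) :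
    Integrable (fun z => ∏ j, (if P j then f j z else 1)) ν := by
  refine (h m).mono' ?_ ?_
  · apply Continuous.aestronglyMeasurable
    refine continuous_finsetProd _ fun j _ => ?_
    by_cases hj : P j
    · simpa [hj] using hc j
    · simpa [hj] using continuous_const
  · refine Filter.Eventually.of_forall fun z => ?_
    rw [norm_prod]
    calc _ ≤ ∏ _j : Fin m, (1 + ‖z‖) := by
          refine Finset.prod_le_prod (fun _ _ => norm_nonneg _) fun j _ => ?_
          split_ifs
          · exact hn j z
          · simp
      _ = _ := by simp

lemma mom_of_memLp {ν : Measure ℂ} [IsProbabilityMeasure ν]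
    (h : ∀ p : ℕ, MemLp (fun z : ℂ => z) p ν) : Mom ν := by
  intro p
  have h1 : MemLp (fun z : ℂ => 1 + ‖z‖) p ν := (memLp_const (1 : ℝ)).add (h p).norm
  have := h1.integrable_norm_pow'
  refine this.congr (Filter.Eventually.of_forall fun z => ?_)
  have : 0 ≤ 1 + ‖z‖ := by positivity
  simp only [Real.norm_eq_abs, abs_of_nonneg this]

lemma mom_compact {μ : Measure ℂ} [IsProbabilityMeasure μ]
    (hμ : ∃ K : Set ℂ, IsCompact K ∧ μ Kᶜ = 0) : Mom μ := by
  obtain ⟨K, hK, h0⟩ := hμ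
  intro p
  have : IntegrableOn (fun z : ℂ => (1 + ‖z‖) ^ p) K μ :=
    ContinuousOn.integrableOn_compact hK (by fun_prop)
  rwa [IntegrableOn, Measure.restrict_eq_self_of_ae_mem (by rwa [ae_iff])] at this

lemma mom_dirac : Mom (Measure.dirac 0) := by
  intro p
  exact integrable_dirac (by simp)

lemma meas_cg : Measurable (fun p : ℝ × ℝ => (p.1 : ℂ) + (p.2 : ℂ) * Complex.I) := by fun_prop

instance (v : ℝ≥0) : IsProbabilityMeasure (complexGaussian v) :=
  Measure.isProbabilityMeasure_map meas_cg.aemeasurable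

lemma mom_cg (v : ℝ≥0) : Mom (complexGaussian v) := by
  apply mom_of_memLp
  intro p
  unfold complexGaussian
  rw [memLp_map_measure_iff (by fun_prop) meas_cg.aemeasurable]
  have h := memLp_id_gaussianReal' (μ := 0) (v := v / 2) (p : ℝ≥0∞) (by simp)
  have h1 : MemLp (fun x : ℝ => (x : ℂ)) p (gaussianReal 0 (v / 2)) := h.ofReal
  have h2 : MemLp (fun q : ℝ × ℝ => (q.1 : ℂ)) p ((gaussianReal 0 (v / 2)).prod (gaussianReal 0 (v / 2))) := h1.comp_fst _
  have h3 : MemLp (fun q : ℝ × ℝ => (q.2 : ℂ)) p ((gaussianReal 0 (v / 2)).prod (gaussianReal 0 (v / 2))) := h1.comp_snd _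
  exact h2.add (h3.mul_const Complex.I)

lemma cg_mean (v : ℝ≥0) : ∫ z, z ∂(complexGaussian v) = 0 := by
  unfold complexGaussian
  rw [integral_map meas_cg.aemeasurable (by fun_prop)]
  have h := memLp_id_gaussianReal' (μ := 0) (v := v / 2) 1 (by simp)
  have h1 : MemLp (fun x : ℝ => (x : ℂ)) 1 (gaussianReal 0 (v / 2)) := h.ofReal
  have h2 : MemLp (fun q : ℝ × ℝ => (q.1 : ℂ)) 1 ((gaussianReal 0 (v / 2)).prod (gaussianReal 0 (v / 2))) := h1.comp_fst _
  have h3 : MemLp (fun q : ℝ × ℝ => (q.2 : ℂ)) 1 ((gaussianReal 0 (v / 2)).prod (gaussianReal 0 (v / 2))) := h1.comp_snd _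
  rw [integral_add (memLp_one_iff_integrable.1 h2) ((memLp_one_iff_integrable.1 h3).mul_const _),
    integral_mul_const, integral_fun_fst (fun x : ℝ => (x : ℂ)), integral_fun_snd (fun x : ℝ => (x : ℂ)), integral_complex_ofReal]
  simp [integral_id_gaussianReal]

lemma cg_fT_mean (v : ℝ≥0) (l : Letter) (hl : tauL l = 1) :
    ∫ z, fT l z ∂(complexGaussian v) = 0 := by
  cases l
  · simp [tauL] at hl
  · simp [tauL] at hl
  · exact cg_mean v
  · have := integral_conj (μ := complexGaussian v) (f := fun z : ℂ => z)
    simp only [fT]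
    rw [cg_mean, map_zero] at this
    exact this

lemma cg_scale (c : ℝ) (v v' : ℝ≥0) (h : (v' : ℝ) = c ^ 2 * v) :
    complexGaussian v' = (complexGaussian v).map (fun z => (c : ℂ) * z) := by
  have hg : gaussianReal 0 (v' / 2) = (gaussianReal 0 (v / 2)).map (c * ·) := by
    rw [gaussianReal_map_const_mul, mul_zero]
    congr 1
    ext
    simp [h]; ring
  unfold complexGaussian
  rw [hg, Measure.map_map (by fun_prop) meas_cg, Measure.map_prod_map _ _ (by fun_prop) (by fun_prop),
    Measure.map_map meas_cg (by fun_prop)]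
  congr 1
  ext p
  simp [Prod.map]; ring

lemma entM_scale {n : ℕ} (c : ℝ) (v v' : ℝ≥0) (h : (v' : ℝ) = c ^ 2 * v) (x : Fin n × Fin n) :
    entM (complexGaussian v') x = (entM (complexGaussian v) x).map (fun z => (c : ℂ) * z) := by
  unfold entM
  split_ifs
  · exact cg_scale c v v' h
  · rw [Measure.map_dirac' (by fun_prop)]; simp

instance {n : ℕ} (v : ℝ≥0) (x : Fin n × Fin n) : IsProbabilityMeasure (entM (complexGaussian v) x) := by
  unfold entM; split_ifs <;> infer_instance

lemma mom_entM {n : ℕ} (v : ℝ≥0) (x : Fin n × Fin n) : Mom (entM (complexGaussian v) x) := by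
  unfold entM; split_ifs
  · exact mom_cg v
  · exact mom_dirac

lemma fT_scale (l : Letter) (c : ℝ) (z : ℂ) : fT l (c * z) = (c : ℂ) ^ tauL l * fT l z := by
  cases l <;> simp [fT, tauL]

lemma Fm_scale {m n : ℕ} (μ : Measure ℂ) (w : Fin m → Letter) (c : ℝ) (v v' : ℝ≥0)
    (h : (v' : ℝ) = c ^ 2 * v) (i : Fin (m + 1) → Fin n) :
    Fm μ w (complexGaussian v') i = (c : ℂ) ^ (∑ j, tauL (w j)) * Fm μ w (complexGaussian v) i := by
  have key : ∀ x : Fin n × Fin n,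
      ∫ z, ∏ j, (if posL (w j) (i j.castSucc) (i j.succ) = x then fT (w j) z else 1)
        ∂(entM (complexGaussian v') x) =
      (∏ j, (if posL (w j) (i j.castSucc) (i j.succ) = x then (c : ℂ) ^ tauL (w j) else 1)) *
      ∫ z, ∏ j, (if posL (w j) (i j.castSucc) (i j.succ) = x then fT (w j) z else 1)
        ∂(entM (complexGaussian v) x) := by
    intro x
    rw [entM_scale c v v' h, integral_map (by fun_prop), ← integral_const_mul]
    · congr 1
      ext z
      rw [← Finset.prod_mul_distrib]
      apply Finset.prod_congr rfl
      intro j _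
      split_ifs
      · exact fT_scale _ _ _
      · simp
    · apply Continuous.aestronglyMeasurable
      refine continuous_finsetProd _ fun j _ => ?_
      split_ifs
      · exact continuous_fT _
      · exact continuous_const
  have hp : ∏ x : Fin n × Fin n,
      (∏ j, (if posL (w j) (i j.castSucc) (i j.succ) = x then (c : ℂ) ^ tauL (w j) else 1)) =
      (c : ℂ) ^ (∑ j, tauL (w j)) := by
    rw [Finset.prod_comm, ← Finset.prod_pow_eq_pow_sum]
    apply Finset.prod_congr rfl
    intro j _
    simp
  unfold Fm
  simp_rw [key]
  rw [Finset.prod_mul_distrib, hp]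
  ring

lemma int_pi {n : ℕ} {E : Type*} [MeasurableSpace E] (ν : Fin n → Measure E) [∀ i, SigmaFinite (ν i)] (f : Fin n → E → ℂ)
   (h : ∀ i, Integrable (f i) (ν i)) : Integrable (fun x : Fin n → E => ∏ i, f i (x i)) (Measure.pi ν) :=
  Integrable.fintype_prod h

lemma e1 {m n : ℕ} (μ : Measure ℂ) [IsProbabilityMeasure μ] (hμ : Mom μ)
    (w : Fin m → Letter) (i : Fin (m+1) → Fin n): Integrable (fun d : Fin n → ℂ => ∏ a, ∏ j, (if i j.castSucc = a then fD (w j) (d a) else 1))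
        (Measure.pi fun _ : Fin n => μ) := by
      have := int_pi (fun _ => μ) (fun (a : Fin n) (z : ℂ) => ∏ j : Fin m, (if i j.castSucc = a then fD (w j) z else 1)) fun a => mom_int hμ (fun j => i j.castSucc = a) (fun j => fD (w j)) (fun j => continuous_fD _) (fun j => norm_fD _)
      exact this

lemma e2 {m n : ℕ} (v : ℝ≥0)
    (w : Fin m → Letter) (i : Fin (m+1) → Fin n) :
    Integrable (fun t : Fin n → Fin n → ℂ => ∏ a, ∏ b, ∏ j, (if posL (w j) (i j.castSucc) (i j.succ) = (a, b) then
          fT (w j) (t a b) else 1)) (Measure.pi fun a => Measure.pi fun b => entM (complexGaussian v) (a, b)) := by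
  have := int_pi (fun a => Measure.pi fun b => entM (complexGaussian v) (a, b)) (fun (a : Fin n) (t : Fin n → ℂ) => ∏ b, ∏ j, (if posL (w j) (i j.castSucc) (i j.succ) = (a, b) then
          fT (w j) (t b) else 1)) fun a => by
    have := int_pi (fun b => entM (complexGaussian v) (a, b)) (fun (b : Fin n) (z : ℂ) => ∏ j, (if posL (w j) (i j.castSucc) (i j.succ) = (a, b) then
          fT (w j) z else 1)) fun b => mom_int (mom_entM _ (a, b)) (fun j => posL (w j) (i j.castSucc) (i j.succ) = (a, b)) (fun j => fT (w j)) (fun j => continuous_fT _) (fun j => norm_fT _)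
    exact this
  exact this

lemma int_prod2 {E F : Type*} [MeasurableSpace E] [MeasurableSpace F] (ν : Measure E) (ρ : Measure F) [SigmaFinite ν] [SigmaFinite ρ]
    (f : E → ℂ) (g : F → ℂ) (hf : Integrable f ν) (hg : Integrable g ρ) :
    Integrable (fun x : E × F => f x.1 * g x.2) (ν.prod ρ) := hf.mul_prod hg

set_option maxHeartbeats 400000 in
lemma expect_eq {m n : ℕ} (μ : Measure ℂ) [IsProbabilityMeasure μ] (hμ : Mom μ)
    (w : Fin m → Letter) :
    ∫ x : (Fin n → ℂ) × (Fin n → Fin n → ℂ),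
          (n : ℂ)⁻¹ *
            (List.ofFn fun j : Fin m => interp x.1 (Matrix.of x.2) (w j)).prod.trace
          ∂((Measure.pi fun _ : Fin n => μ).prod (GTlaw n)) =
    (n : ℂ)⁻¹ * ∑ i : Fin (m + 1) → Fin n, Fm μ w (complexGaussian (n : ℝ≥0)⁻¹) i := by
  set γ := complexGaussian (n : ℝ≥0)⁻¹ with hγ
  have hGT : GTlaw n = Measure.pi fun a => Measure.pi fun b => entM γ (a, b) := rfl
  have hpt : ∀ (x : (Fin n → ℂ) × (Fin n → Fin n → ℂ)),
      (List.ofFn fun j : Fin m => interp x.1 (Matrix.of x.2) (w j)).prod.trace =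
      ∑ i : Fin (m + 1) → Fin n,
        ((if i 0 = i (Fin.last m) then 1 else 0) * ∏ j, cL (w j) (i j.castSucc) (i j.succ)) *
        ((∏ a, ∏ j, (if i j.castSucc = a then fD (w j) (x.1 a) else 1)) *
        ∏ a, ∏ b, ∏ j, (if posL (w j) (i j.castSucc) (i j.succ) = (a, b) then
          fT (w j) (x.2 a b) else 1)) := by
    intro x
    rw [trace_path]
    apply Finset.sum_congr rfl
    intro i _
    simp_rw [interp_apply]
    rw [Finset.prod_mul_distrib, Finset.prod_mul_distrib, mul_assoc]
    rw [prod_regroup (fun j : Fin m => i j.castSucc) (fun j => fD (w j)) x.1]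
    rw [prod_regroup (fun j : Fin m => posL (w j) (i j.castSucc) (i j.succ)) (fun j => fT (w j))
      (fun y : Fin n × Fin n => x.2 y.1 y.2), Fintype.prod_prod_type]
  simp_rw [hpt]
  rw [integral_const_mul]
  congr 1
  have : ∀ a : Fin n, SigmaFinite (Measure.pi fun b => entM γ (a, b)) := fun a => inferInstance
  rw [hGT, integral_finsetSum]
  · apply Finset.sum_congr rfl
    intro i _
    rw [integral_const_mul]
    unfold Fm
    congr 1
    rw [integral_prod_mul (fun d : Fin n → ℂ => ∏ a, ∏ j, (if i j.castSucc = a then fD (w j) (d a) else 1))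
      (fun t : Fin n → Fin n → ℂ => ∏ a, ∏ b, ∏ j, (if posL (w j) (i j.castSucc) (i j.succ) = (a, b) then
          fT (w j) (t a b) else 1))]
    rw [integral_fintype_prod_eq_prod (fun (a : Fin n) (z : ℂ) => ∏ j, (if i j.castSucc = a then fD (w j) z else 1))]
    rw [integral_fintype_prod_eq_prod (fun (a : Fin n) (t : Fin n → ℂ) => ∏ b, ∏ j, (if posL (w j) (i j.castSucc) (i j.succ) = (a, b) then
          fT (w j) (t b) else 1)), Fintype.prod_prod_type]
    congr 1
    apply Finset.prod_congr rfl
    intro a _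
    rw [integral_fintype_prod_eq_prod (fun (b : Fin n) (z : ℂ) => ∏ j, (if posL (w j) (i j.castSucc) (i j.succ) = (a, b) then
          fT (w j) z else 1))]
  · intro i _
    refine Integrable.const_mul ?_ _
    have := int_prod2 _ _ _ _ (e1 μ hμ w i) (e2 (n : ℝ≥0)⁻¹ w i)
    exact this

lemma cL_emb {k n : ℕ} (e : Fin k ↪o Fin n) (l : Letter) (a b : Fin k) :
    cL l (e a) (e b) = cL l a b := by
  cases l <;> simp [cL]

lemma posL_map {α β : Type*} (e : α → β) (l : Letter) (a b : α) :
    posL l (e a) (e b) = Prod.map e e (posL l a b) := by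
  cases l <;> simp [posL]

lemma Fm_emb {m k n : ℕ} (μ : Measure ℂ) [IsProbabilityMeasure μ] (w : Fin m → Letter) (v : ℝ≥0)
    (e : Fin k ↪o Fin n) (p : Fin (m + 1) → Fin k) :
    Fm μ w (complexGaussian v) (fun j => e (p j)) = Fm μ w (complexGaussian v) p := by
  unfold Fm
  simp only [cL_emb, EmbeddingLike.apply_eq_iff_eq, posL_map e]
  congr 2
  · symm
    apply Fintype.prod_of_injective e e.injective
    · intro a ha
      have : ∀ j : Fin m, ¬ (e (p j.castSucc) = a) := fun j hj => ha ⟨_, hj⟩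
      simp [this]
    · intro a
      simp only [EmbeddingLike.apply_eq_iff_eq]
  · symm
    have hinj : Function.Injective (Prod.map e e) := e.injective.prodMap e.injective
    apply Fintype.prod_of_injective (Prod.map e e) hinj
    · intro x hx
      have : ∀ j : Fin m, ¬ (Prod.map e e (posL (w j) (p j.castSucc) (p j.succ)) = x) :=
        fun j hj => hx ⟨_, hj⟩
      have h1 : ∀ z : ℂ, (∏ j : Fin m, (if Prod.map e e (posL (w j) (p j.castSucc) (p j.succ)) = x
          then fT (w j) z else 1)) = 1 := fun z =>
        Finset.prod_eq_one fun j _ => if_neg (this j)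
      refine (integral_congr_ae (Filter.Eventually.of_forall h1)).trans ?_
      rw [integral_const, probReal_univ, one_smul]
    · intro x
      have : entM (complexGaussian v) (Prod.map e e x) = entM (complexGaussian v) x := by
        simp only [entM, Prod.map_fst, Prod.map_snd, Fin.val_fin_lt, OrderEmbedding.lt_iff_lt]
      rw [this]
      simp only [hinj.eq_iff]

noncomputable def aK {m : ℕ} (μ : Measure ℂ) (w : Fin m → Letter) (k : ℕ) : ℂ :=
  ∑ p : Fin (m + 1) → Fin k with Finset.univ.image p = Finset.univ, Fm μ w (complexGaussian 1) p

lemma sum_Fm {m n : ℕ} (μ : Measure ℂ) [IsProbabilityMeasure μ] (w : Fin m → Letter) :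
    ∑ i : Fin (m + 1) → Fin n, Fm μ w (complexGaussian 1) i =
      ∑ k ∈ Finset.range (n + 1), (n.choose k : ℂ) * aK μ w k := by
  have h1 : ∀ S : Finset (Fin n),
      ∑ i : Fin (m + 1) → Fin n with Finset.univ.image i = S, Fm μ w (complexGaussian 1) i =
        aK μ w S.card := by
    intro S
    unfold aK
    symm
    set e := S.orderEmbOfFin rfl with he
    have hr : Set.range e = S := Finset.range_orderEmbOfFin S rfl
    refine Finset.sum_nbij (fun p j => e (p j)) ?_ ?_ ?_ ?_
    · intro p hp
      simp only [Finset.mem_filter, Finset.mem_univ, true_and] at hp ⊢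
      have : Finset.univ.image (fun j => e (p j)) = (Finset.univ.image p).image e := by
        rw [Finset.image_image]; rfl
      rw [this, hp]
      apply Finset.coe_injective
      simp [hr]
    · intro p _ q _ hpq
      funext j
      exact e.injective (congrFun hpq j)
    · intro i hi
      simp only [Finset.coe_filter, Finset.mem_univ, true_and, Set.mem_ofPred_eq] at hi
      have hm : ∀ j, ∃ a, e a = i j := by
        intro j
        have : i j ∈ Set.range e := by
          rw [hr, ← hi]; simp
        exact this
      choose p hp using hm
      refine ⟨p, ?_, funext hp⟩
      simp only [Finset.coe_filter, Finset.mem_univ, true_and, Set.mem_ofPred_eq]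
      rw [Finset.eq_univ_iff_forall]
      intro a
      have : e a ∈ S := by
        have : e a ∈ (S : Set (Fin n)) := hr ▸ ⟨a, rfl⟩
        simpa using this
      have this : e a ∈ Finset.univ.image i := hi.symm.subset this
      obtain ⟨j, -, hj⟩ := Finset.mem_image.1 this
      rw [← hp] at hj
      exact Finset.mem_image.2 ⟨j, Finset.mem_univ _, e.injective hj⟩
    · intro p _
      exact (Fm_emb μ w 1 e p).symm
  rw [← Finset.sum_fiberwise_of_maps_to (t := (Finset.univ : Finset (Fin n)).powerset)
    (g := fun i => Finset.univ.image i) (by simp)]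
  simp_rw [h1]
  rw [Finset.sum_powerset_apply_card (fun k => aK μ w k)]
  simp

lemma fT_zero (l : Letter) (h : tauL l = 1) : fT l 0 = 0 := by
  cases l <;> simp_all [tauL, fT]

lemma tau_cases (l : Letter) : tauL l = 0 ∨ tauL l = 1 := by cases l <;> simp [tauL]

lemma fT_tau0 (l : Letter) (h : tauL l = 0) (z : ℂ) : fT l z = 1 := by
  cases l <;> simp_all [tauL, fT]

lemma Fm_vanish {m k : ℕ} (μ : Measure ℂ) (w : Fin m → Letter) (v : ℝ≥0)
    (p : Fin (m + 1) → Fin k) (hp : Finset.univ.image p = Finset.univ)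
    (h : Fm μ w (complexGaussian v) p ≠ 0) : 2 * k ≤ 2 + ∑ j, tauL (w j) := by
  unfold Fm at h
  have hc := right_ne_zero_of_mul (left_ne_zero_of_mul h)
  have hG := right_ne_zero_of_mul (right_ne_zero_of_mul h)
  rw [Finset.prod_ne_zero_iff] at hc hG
  have hD : ∀ j, tauL (w j) = 0 → p j.castSucc = p j.succ := by
    intro j hj
    have := hc j (Finset.mem_univ _)
    revert this hj
    cases w j <;> simp [tauL, cL]
  have hw := walk_card m p w hD
  rw [hp, Finset.card_univ, Fintype.card_fin] at hw
  set T := Finset.univ.filter fun j => tauL (w j) = 1 with hT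
  have hsum : ∑ j, tauL (w j) = T.card := by
    rw [hT, Finset.card_filter]
    apply Finset.sum_congr rfl
    intro j _
    rcases tau_cases (w j) with h | h <;> simp [h]
  have h2 := Finset.mul_card_image_le_card (f := fun j => posL (w j) (p j.castSucc) (p j.succ)) T 2 (by
    intro x hx
    obtain ⟨j, hj, hjx⟩ := Finset.mem_image.1 hx
    have hj1 : tauL (w j) = 1 := by simpa [hT] using hj
    have hg := hG x (Finset.mem_univ _)
    have hjm : j ∈ T.filter fun a => posL (w a) (p a.castSucc) (p a.succ) = x :=
      Finset.mem_filter.2 ⟨hj, hjx⟩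
    by_contra hlt
    push Not at hlt
    have hone : ∀ j' ∈ T.filter fun a => posL (w a) (p a.castSucc) (p a.succ) = x, j' = j := by
      intro j' hj'
      have : (T.filter fun a => posL (w a) (p a.castSucc) (p a.succ) = x).card ≤ 1 := by omega
      exact Finset.card_le_one.1 this _ hj' _ hjm
    apply hg
    have hfun : ∀ z, ∏ j, (if posL (w j) (p j.castSucc) (p j.succ) = x then fT (w j) z else 1)
        = fT (w j) z := by
      intro z
      rw [Finset.prod_eq_single j]
      · rw [if_pos hjx]
      · intro j' _ hne
        split_ifs with hx'
        · rcases tau_cases (w j') with h | h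
          · exact fT_tau0 _ h z
          · exact absurd (hone j' (Finset.mem_filter.2 ⟨by simpa [hT] using h, hx'⟩)) hne
        · rfl
      · simp
    simp_rw [hfun]
    unfold entM
    split_ifs
    · exact cg_fT_mean v _ hj1
    · rw [integral_dirac, fT_zero _ hj1])
  omega

lemma aK_vanish {m k : ℕ} (μ : Measure ℂ) (w : Fin m → Letter)
    (h : ¬ 2 * k ≤ 2 + ∑ j, tauL (w j)) : aK μ w k = 0 := by
  apply Finset.sum_eq_zero
  intro p hp
  by_contra h0
  exact h (Fm_vanish μ w 1 p (by simpa using hp) h0)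

lemma choose_lim (k t : ℕ) (h : 2 * k ≤ 2 + t) : ∃ L : ℝ, Filter.Tendsto
    (fun n : ℕ => (n : ℝ)⁻¹ * (√(n : ℝ))⁻¹ ^ t * (n.choose k : ℝ)) Filter.atTop (nhds L) := by
  obtain ⟨s, hs⟩ := Nat.exists_eq_add_of_le h
  have h1 : Filter.Tendsto (fun n : ℕ => (n.choose k : ℝ) * ((n : ℝ)⁻¹) ^ k) Filter.atTop
      (nhds (1 ^ k / k.factorial)) := by
    apply tendsto_choose_mul_pow_atTop (p := fun n : ℕ => (n : ℝ)⁻¹)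
    refine tendsto_const_nhds.congr' ?_
    filter_upwards [Filter.eventually_gt_atTop 0] with n hn
    have : (n : ℝ) ≠ 0 := by positivity
    field_simp
  have h2 : Filter.Tendsto (fun n : ℕ => (√(n : ℝ))⁻¹ ^ s) Filter.atTop (nhds (0 ^ s)) := by
    apply Filter.Tendsto.pow
    exact tendsto_inv_atTop_zero.comp (Real.tendsto_sqrt_atTop.comp tendsto_natCast_atTop_atTop)
  refine ⟨_, (h1.mul h2).congr' ?_⟩
  refine Filter.Eventually.of_forall fun n => ?_
  have hq : (n : ℝ)⁻¹ = (√(n : ℝ))⁻¹ ^ 2 := by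
    rw [inv_pow, Real.sq_sqrt (Nat.cast_nonneg n)]
  simp only
  rw [hq, ← pow_mul, ← pow_add, hs, pow_add]
  ring

/-- Convergence of joint `*`-moments of the pair `(D_n, T_n)`, where `D_n` has i.i.d.
`μ`-distributed diagonal entries, `T_n` has law `GT(n)`, and `D_n, T_n` are independent:
for every word `w` in `D, D*, T, T*`, the expectation of the normalized trace of the
corresponding matrix word converges as `n → ∞`. -/
theorem stmt14 (μ : Measure ℂ) [IsProbabilityMeasure μ]
    (hμ : ∃ K : Set ℂ, IsCompact K ∧ μ Kᶜ = 0)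
    (m : ℕ) (hm : 1 ≤ m) (w : Fin m → Letter) :
    ∃ L : ℂ, Filter.Tendsto
      (fun n : ℕ =>
        ∫ x : (Fin n → ℂ) × (Fin n → Fin n → ℂ),
          (n : ℂ)⁻¹ *
            (List.ofFn fun j : Fin m => interp x.1 (Matrix.of x.2) (w j)).prod.trace
          ∂((Measure.pi fun _ : Fin n => μ).prod (GTlaw n)))
      Filter.atTop (nhds L) := by
  have hM := mom_compact hμ
  set t := ∑ j, tauL (w j) with ht
  have hL : ∀ k : ℕ, ∃ L : ℂ, Filter.Tendsto (fun n : ℕ =>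
      (((n : ℝ)⁻¹ * (√(n : ℝ))⁻¹ ^ t * (n.choose k : ℝ) : ℝ) : ℂ) * aK μ w k)
      Filter.atTop (nhds L) := by
    intro k
    by_cases hk : 2 * k ≤ 2 + t
    · obtain ⟨L, hL⟩ := choose_lim k t hk
      exact ⟨L * aK μ w k, ((Complex.continuous_ofReal.tendsto L).comp hL).mul_const _⟩
    · refine ⟨0, ?_⟩
      rw [aK_vanish μ w hk]
      simp
  choose L hL using hL
  refine ⟨∑ k ∈ Finset.range (t + 3), L k, ?_⟩
  refine (tendsto_finsetSum (Finset.range (t + 3)) fun k _ => hL k).congr' ?_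
  filter_upwards [Filter.eventually_ge_atTop (t + 3)] with n hn
  rw [expect_eq μ hM w]
  have hn0 : (n : ℝ) ≠ 0 := by
    have : 0 < n := by omega
    positivity
  have hsc : ∀ i : Fin (m + 1) → Fin n, Fm μ w (complexGaussian (n : ℝ≥0)⁻¹) i =
      (((√(n : ℝ))⁻¹ : ℝ) : ℂ) ^ t * Fm μ w (complexGaussian 1) i := by
    intro i
    apply Fm_scale
    rw [inv_pow, Real.sq_sqrt (Nat.cast_nonneg n)]
    simp
  simp_rw [hsc]
  rw [← Finset.mul_sum, sum_Fm μ w, Finset.mul_sum, Finset.mul_sum]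
  have hsub : Finset.range (t + 3) ⊆ Finset.range (n + 1) := by
    intro x hx
    simp only [Finset.mem_range] at *
    omega
  rw [← Finset.sum_subset hsub]
  · apply Finset.sum_congr rfl
    intro k _
    push_cast
    ring
  · intro k _ hk
    simp only [Finset.mem_range] at hk
    rw [aK_vanish μ w (by omega)]
    simp
end

section
/- For each n ≥ 1, let T_n be a strictly upper triangular random matrix with law GT(n). Then for every p ≥ 1, lim_{n→∞} E[tr_n((T_n*·T_n)^p)] = p^p/(p+1)!. -/
open MeasureTheory ProbabilityTheory Matrix
open scoped ENNReal NNReal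

set_option linter.unusedSimpArgs false
set_option linter.unusedSectionVars false

namespace GTaux

lemma integrable_poly_gauss (v : ℝ≥0) (P : Polynomial ℂ) :
    Integrable (fun x : ℝ => P.eval (x : ℂ)) (gaussianReal 0 v) := by
  simp only [Polynomial.eval_eq_sum_range]
  refine integrable_finsetSum _ fun i _ => Integrable.const_mul ?_ _
  have h : Integrable (fun x : ℝ => x ^ i) (gaussianReal 0 v) := by
    have := (memLp_id_gaussianReal' (μ := 0) (v := v) (i : ℝ≥0∞) (by simp)).integrable_norm_pow'
    refine this.mono' (by fun_prop) ?_
    filter_upwards with x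
    simp
  have := h.ofReal (𝕜 := ℂ)
  simpa using this

lemma hasDerivAt_pdf {v : ℝ≥0} (hv : v ≠ 0) (x : ℝ) :
    HasDerivAt (gaussianPDFReal 0 v) (-(x / v) * gaussianPDFReal 0 v x) x := by
  have hv' : (v : ℝ) ≠ 0 := by exact_mod_cast hv
  unfold gaussianPDFReal
  have h1 : HasDerivAt (fun x : ℝ => -(x - 0) ^ 2 / (2 * v)) (-(x / v)) x := by
    have := (((hasDerivAt_id x).sub_const 0).pow 2).neg.div_const (2 * (v : ℝ))
    refine this.congr_deriv ?_
    simp; field_simp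
  refine ((h1.exp).const_mul _).congr_deriv ?_
  ring

lemma stein {v : ℝ≥0} (hv : v ≠ 0) (P : Polynomial ℂ) :
    ∫ x : ℝ, (x : ℂ) * P.eval (x : ℂ) ∂(gaussianReal 0 v)
      = (v : ℂ) * ∫ x : ℝ, P.derivative.eval (x : ℂ) ∂(gaussianReal 0 v) := by
  have hv' : (v : ℂ) ≠ 0 := by exact_mod_cast hv
  have key : ∀ Q : Polynomial ℂ,
      Integrable (fun x : ℝ => gaussianPDFReal 0 v x • Q.eval (x : ℂ)) := by
    intro Q
    have := integrable_poly_gauss v Q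
    rw [gaussianReal_of_var_ne_zero _ hv,
      integrable_withDensity_iff_integrable_smul₀' (by fun_prop) (by simp [gaussianPDF])] at this
    refine this.congr ?_
    filter_upwards with x
    rw [toReal_gaussianPDF]
  have hd : ∀ x : ℝ, HasDerivAt (fun x : ℝ => gaussianPDFReal 0 v x • P.eval (x : ℂ))
      (gaussianPDFReal 0 v x • P.derivative.eval (x : ℂ)
        - (v : ℂ)⁻¹ • gaussianPDFReal 0 v x • (Polynomial.X * P).eval (x : ℂ)) x := by
    intro x
    have h1 : HasDerivAt (fun x : ℝ => P.eval (x : ℂ)) (P.derivative.eval (x : ℂ)) x :=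
      (P.hasDerivAt (x : ℂ)).comp_ofReal
    refine ((hasDerivAt_pdf hv x).smul h1).congr_deriv ?_
    simp
    field_simp
    ring
  have := integral_eq_zero_of_hasDerivAt_of_integrable hd
    ((key _).sub ((key _).smul ((v : ℂ)⁻¹))) (key P)
  have hsm : Integrable (fun x : ℝ => (v : ℂ)⁻¹ • gaussianPDFReal 0 v x •
      (Polynomial.X * P).eval (x : ℂ)) := (key _).smul ((v : ℂ)⁻¹)
  rw [integral_sub (key _) hsm, integral_smul, sub_eq_zero] at this
  rw [integral_gaussianReal_eq_integral_smul hv, integral_gaussianReal_eq_integral_smul hv, this]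
  simp only [Polynomial.eval_mul, Polynomial.eval_X, smul_eq_mul]
  field_simp

instance (v : ℝ≥0) : IsProbabilityMeasure (complexGaussian v) := by
  unfold complexGaussian
  exact Measure.isProbabilityMeasure_map (by fun_prop)

lemma integrable_mono_prod (v : ℝ≥0) (a b : ℕ) :
    Integrable (fun p : ℝ × ℝ => ((p.1 : ℂ) + p.2 * Complex.I) ^ a *
      (((p.1 : ℂ) - p.2 * Complex.I) ^ b)) ((gaussianReal 0 v).prod (gaussianReal 0 v)) := by
  have h : ∀ i j : ℕ, Integrable (fun p : ℝ × ℝ => (p.1 : ℂ) ^ i * (p.2 : ℂ) ^ j)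
      ((gaussianReal 0 v).prod (gaussianReal 0 v)) := by
    intro i j
    have h1 := integrable_poly_gauss v (Polynomial.X ^ i)
    have h2 := integrable_poly_gauss v (Polynomial.X ^ j)
    simp only [Polynomial.eval_pow, Polynomial.eval_X] at h1 h2
    exact h1.mul_prod h2
  simp only [sub_eq_add_neg, add_pow, Finset.sum_mul_sum]
  refine integrable_finsetSum _ fun i _ => integrable_finsetSum _ fun j _ => ?_
  refine ((h (i + j) ((a - i) + (b - j))).const_mul
    (Complex.I ^ (a - i) * (-Complex.I) ^ (b - j) * (a.choose i) * (b.choose j))).congr ?_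
  filter_upwards with p
  rw [← mul_neg, mul_pow, mul_pow]
  ring

lemma integrable_mono (v : ℝ≥0) (a b : ℕ) :
    Integrable (fun z : ℂ => z ^ a * (star z) ^ b) (complexGaussian v) := by
  unfold complexGaussian
  rw [integrable_map_measure (by fun_prop) (by fun_prop)]
  refine (integrable_mono_prod (v / 2) a b).congr ?_
  filter_upwards with p
  simp [sub_eq_add_neg]

lemma integral_mono (v : ℝ≥0) (a b : ℕ) :
    ∫ z, z ^ a * (star z) ^ b ∂(complexGaussian v) =
    ∫ p : ℝ × ℝ, ((p.1 : ℂ) + p.2 * Complex.I) ^ a *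
      (((p.1 : ℂ) - p.2 * Complex.I) ^ b)
        ∂((gaussianReal 0 (v / 2)).prod (gaussianReal 0 (v / 2))) := by
  unfold complexGaussian
  rw [integral_map (by fun_prop) (by fun_prop)]
  simp [sub_eq_add_neg]

/-- Wick recursion in one variable. -/
lemma wick_one {v : ℝ≥0} (hv : v ≠ 0) (a b : ℕ) :
    ∫ z, z ^ (a + 1) * (star z) ^ b ∂(complexGaussian v) =
      (v : ℂ) * (b * ∫ z, z ^ a * (star z) ^ (b - 1) ∂(complexGaussian v)) := by
  have hw : v / 2 ≠ 0 := by positivity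
  simp only [integral_mono]
  set γ := gaussianReal 0 (v / 2)
  set w : ℂ := ((v / 2 : ℝ≥0) : ℂ) with hwdef
  have hw2 : w = v / 2 := by simp [hwdef]
  -- general integrability in mixed form
  let I (a b : ℕ) : ℂ := ∫ p : ℝ × ℝ, ((p.1 : ℂ) + p.2 * Complex.I) ^ a *
      (((p.1 : ℂ) - p.2 * Complex.I) ^ b) ∂(γ.prod γ)
  have hI := integrable_mono_prod (v / 2)
  have hx : ∫ p : ℝ × ℝ, (p.1 : ℂ) * (((p.1 : ℂ) + p.2 * Complex.I) ^ a *
      (((p.1 : ℂ) - p.2 * Complex.I) ^ b)) ∂(γ.prod γ)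
      = w * (a * I (a - 1) b + b * I a (b - 1)) := by
    have e1 : Integrable (fun p : ℝ × ℝ => (p.1 : ℂ) * (((p.1 : ℂ) + p.2 * Complex.I) ^ a *
      (((p.1 : ℂ) - p.2 * Complex.I) ^ b))) (γ.prod γ) := by
      refine (((hI (a + 1) b).add (hI a (b + 1))).const_mul (1 / 2 : ℂ)).congr ?_
      filter_upwards with p
      simp only [Pi.add_apply]
      ring
    rw [integral_prod_symm _ e1]
    have e2 : ∀ y : ℝ, ∫ x : ℝ, (x : ℂ) * (((x : ℂ) + y * Complex.I) ^ a *
        (((x : ℂ) - y * Complex.I) ^ b)) ∂γ = w * ∫ x : ℝ, (a * (((x : ℂ) + y * Complex.I) ^ (a - 1) *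
        (((x : ℂ) - y * Complex.I) ^ b)) + b * (((x : ℂ) + y * Complex.I) ^ a *
        (((x : ℂ) - y * Complex.I) ^ (b - 1)))) ∂γ := by
      intro y
      have := stein hw ((Polynomial.X + Polynomial.C (y * Complex.I)) ^ a *
        (Polynomial.X - Polynomial.C (y * Complex.I)) ^ b)
      simp only [Polynomial.derivative_mul, Polynomial.derivative_pow, Polynomial.eval_mul,
        Polynomial.eval_pow, Polynomial.eval_add, Polynomial.eval_sub, Polynomial.eval_X,
        Polynomial.eval_C, Polynomial.derivative_add, Polynomial.derivative_sub,
        Polynomial.derivative_X, Polynomial.derivative_C, add_zero, sub_zero, mul_one,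
        Polynomial.eval_natCast] at this
      rw [this]
      congr 2
      funext x
      ring
    simp only [e2]
    rw [integral_const_mul]
    congr 1
    have e3 := ((hI (a - 1) b).const_mul (a : ℂ))
    have e4 := ((hI a (b - 1)).const_mul (b : ℂ))
    rw [← integral_prod_symm (f := fun p : ℝ × ℝ =>
      (a * (((p.1 : ℂ) + p.2 * Complex.I) ^ (a - 1) *
        (((p.1 : ℂ) - p.2 * Complex.I) ^ b)) + b * (((p.1 : ℂ) + p.2 * Complex.I) ^ a *
        (((p.1 : ℂ) - p.2 * Complex.I) ^ (b - 1))))) (e3.add e4), integral_add e3 e4,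
        integral_const_mul, integral_const_mul]
  have hy : ∫ p : ℝ × ℝ, (p.2 : ℂ) * (((p.1 : ℂ) + p.2 * Complex.I) ^ a *
      (((p.1 : ℂ) - p.2 * Complex.I) ^ b)) ∂(γ.prod γ)
      = w * Complex.I * (a * I (a - 1) b - b * I a (b - 1)) := by
    have e1 : Integrable (fun p : ℝ × ℝ => (p.2 : ℂ) * (((p.1 : ℂ) + p.2 * Complex.I) ^ a *
      (((p.1 : ℂ) - p.2 * Complex.I) ^ b))) (γ.prod γ) := by
      refine (((hI (a + 1) b).sub (hI a (b + 1))).const_mul (-Complex.I / 2 : ℂ)).congr ?_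
      filter_upwards with p
      simp only [Pi.sub_apply]
      ring_nf
      simp
    rw [integral_prod _ e1]
    have e2 : ∀ x : ℝ, ∫ y : ℝ, (y : ℂ) * (((x : ℂ) + y * Complex.I) ^ a *
        (((x : ℂ) - y * Complex.I) ^ b)) ∂γ = w * Complex.I *
          ∫ y : ℝ, (a * (((x : ℂ) + y * Complex.I) ^ (a - 1) *
        (((x : ℂ) - y * Complex.I) ^ b)) - b * (((x : ℂ) + y * Complex.I) ^ a *
        (((x : ℂ) - y * Complex.I) ^ (b - 1)))) ∂γ := by
      intro x
      have := stein hw ((Polynomial.C (x : ℂ) + Polynomial.X * Polynomial.C Complex.I) ^ a *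
        (Polynomial.C (x : ℂ) - Polynomial.X * Polynomial.C Complex.I) ^ b)
      simp only [Polynomial.derivative_mul, Polynomial.derivative_pow, Polynomial.eval_mul,
        Polynomial.eval_pow, Polynomial.eval_add, Polynomial.eval_sub, Polynomial.eval_X,
        Polynomial.eval_C, Polynomial.derivative_add, Polynomial.derivative_sub,
        Polynomial.derivative_X, Polynomial.derivative_C, add_zero, sub_zero, mul_one, zero_add,
        zero_sub, mul_zero, one_mul, Polynomial.eval_neg,
        Polynomial.eval_natCast] at this
      rw [this, mul_assoc, ← integral_const_mul Complex.I]
      congr 2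
      funext x
      ring
    simp only [e2]
    rw [integral_const_mul]
    congr 1
    have e3 := ((hI (a - 1) b).const_mul (a : ℂ))
    have e4 := ((hI a (b - 1)).const_mul (b : ℂ))
    rw [← integral_prod (f := fun p : ℝ × ℝ =>
      (a * (((p.1 : ℂ) + p.2 * Complex.I) ^ (a - 1) *
        (((p.1 : ℂ) - p.2 * Complex.I) ^ b)) - b * (((p.1 : ℂ) + p.2 * Complex.I) ^ a *
        (((p.1 : ℂ) - p.2 * Complex.I) ^ (b - 1))))) (e3.sub e4), integral_sub e3 e4,
        integral_const_mul, integral_const_mul]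
  have e5 : Integrable (fun p : ℝ × ℝ => (p.1 : ℂ) * (((p.1 : ℂ) + p.2 * Complex.I) ^ a *
      (((p.1 : ℂ) - p.2 * Complex.I) ^ b))) (γ.prod γ) := by
    refine (((hI (a + 1) b).add (hI a (b + 1))).const_mul (1 / 2 : ℂ)).congr ?_
    filter_upwards with p
    simp only [Pi.add_apply]
    ring
  have e6 : Integrable (fun p : ℝ × ℝ => Complex.I * ((p.2 : ℂ) * (((p.1 : ℂ) + p.2 * Complex.I) ^ a *
      (((p.1 : ℂ) - p.2 * Complex.I) ^ b)))) (γ.prod γ) := by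
    refine (((hI (a + 1) b).sub (hI a (b + 1))).const_mul (1 / 2 : ℂ)).congr ?_
    filter_upwards with p
    simp only [Pi.sub_apply]
    ring
  have e7 : ∫ p : ℝ × ℝ, ((p.1 : ℂ) + p.2 * Complex.I) ^ (a + 1) *
      (((p.1 : ℂ) - p.2 * Complex.I) ^ b) ∂(γ.prod γ) =
      ∫ p : ℝ × ℝ, ((p.1 : ℂ) * (((p.1 : ℂ) + p.2 * Complex.I) ^ a *
      (((p.1 : ℂ) - p.2 * Complex.I) ^ b)) + Complex.I * ((p.2 : ℂ) * (((p.1 : ℂ) + p.2 * Complex.I) ^ a *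
      (((p.1 : ℂ) - p.2 * Complex.I) ^ b)))) ∂(γ.prod γ) := by
    congr 1
    funext p
    ring
  rw [e7, integral_add e5 e6, integral_const_mul, hx, hy, hw2]
  linear_combination ((v : ℂ) / 2 * (a * I (a - 1) b - b * I a (b - 1))) * Complex.I_mul_I

end GTaux

namespace GTaux
section quad
variable {ι : Type*} [Fintype ι] [DecidableEq ι]

/-- evaluation of a polynomial in the variables `z`, `conj z`. -/
noncomputable def ev (z : ι → ℂ) (f : MvPolynomial (ι ⊕ ι) ℂ) : ℂ :=
  MvPolynomial.eval (Sum.elim z (star z)) f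

lemma ev_monomial (z : ι → ℂ) (s : ι ⊕ ι →₀ ℕ) (a : ℂ) :
    ev z (MvPolynomial.monomial s a) =
      a * ∏ i, ((z i) ^ s (Sum.inl i) * (star (z i)) ^ s (Sum.inr i)) := by
  unfold ev
  rw [MvPolynomial.eval_monomial, Finsupp.prod_fintype _ _ (by simp), Fintype.prod_sum_type,
    Finset.prod_mul_distrib]
  simp

lemma integrable_ev (v : ℝ≥0) (f : MvPolynomial (ι ⊕ ι) ℂ) :
    Integrable (fun z : ι → ℂ => ev z f) (Measure.pi fun _ => complexGaussian v) := by
  induction f using MvPolynomial.induction_on' with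
  | monomial s a =>
    simp only [ev_monomial]
    exact (Integrable.fintype_prod (fun i => integrable_mono v _ _)).const_mul a
  | add p q hp hq =>
    simp only [ev, map_add] at *
    exact hp.add hq

lemma integral_monomial (v : ℝ≥0) (s : ι ⊕ ι →₀ ℕ) (a : ℂ) :
    ∫ z : ι → ℂ, ev z (MvPolynomial.monomial s a) ∂(Measure.pi fun _ => complexGaussian v) =
      a * ∏ i, ∫ w, w ^ s (Sum.inl i) * (star w) ^ s (Sum.inr i) ∂(complexGaussian v) := by
  simp only [ev_monomial]
  rw [integral_const_mul, integral_fintype_prod_eq_prod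
    (fun i w => w ^ s (Sum.inl i) * (star w) ^ s (Sum.inr i))]

lemma wick {v : ℝ≥0} (hv : v ≠ 0) (i : ι) (f : MvPolynomial (ι ⊕ ι) ℂ) :
    ∫ z : ι → ℂ, ev z (MvPolynomial.X (Sum.inl i) * f) ∂(Measure.pi fun _ => complexGaussian v) =
      (v : ℂ) * ∫ z : ι → ℂ, ev z (MvPolynomial.pderiv (Sum.inr i) f)
        ∂(Measure.pi fun _ => complexGaussian v) := by
  induction f using MvPolynomial.induction_on' with
  | monomial s a =>
    rw [MvPolynomial.pderiv_monomial, MvPolynomial.X, MvPolynomial.monomial_mul,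
      integral_monomial, integral_monomial, Fintype.prod_eq_mul_prod_compl i,
      Fintype.prod_eq_mul_prod_compl i]
    have h1 : ∀ j ∈ ({i}ᶜ : Finset ι), (∫ w, w ^ (Finsupp.single (Sum.inl i) 1 + s : ι ⊕ ι →₀ ℕ) (Sum.inl j) *
        (star w) ^ (Finsupp.single (Sum.inl i) 1 + s : ι ⊕ ι →₀ ℕ) (Sum.inr j) ∂(complexGaussian v)) =
        ∫ w, w ^ (s - Finsupp.single (Sum.inr i) 1 : ι ⊕ ι →₀ ℕ) (Sum.inl j) *
        (star w) ^ (s - Finsupp.single (Sum.inr i) 1 : ι ⊕ ι →₀ ℕ) (Sum.inr j) ∂(complexGaussian v) := by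
      intro j hj
      have : i ≠ j := by simpa [eq_comm] using hj
      simp [Finsupp.single_apply, this]
    rw [Finset.prod_congr rfl h1]
    have h2 := wick_one hv (s (Sum.inl i)) (s (Sum.inr i))
    have e1 : (Finsupp.single (Sum.inl i) 1 + s : ι ⊕ ι →₀ ℕ) (Sum.inl i) = s (Sum.inl i) + 1 := by
      simp [add_comm]
    have e2 : (Finsupp.single (Sum.inl i) 1 + s : ι ⊕ ι →₀ ℕ) (Sum.inr i) = s (Sum.inr i) := by
      simp
    have e3 : (s - Finsupp.single (Sum.inr i) 1 : ι ⊕ ι →₀ ℕ) (Sum.inl i) = s (Sum.inl i) := by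
      simp
    have e4 : (s - Finsupp.single (Sum.inr i) 1 : ι ⊕ ι →₀ ℕ) (Sum.inr i) = s (Sum.inr i) - 1 := by
      simp
    rw [e1, e2, e3, e4, h2]
    ring
  | add p q hp hq =>
    have h1 := integrable_ev (ι := ι) v (MvPolynomial.X (Sum.inl i) * p)
    have h2 := integrable_ev (ι := ι) v (MvPolynomial.X (Sum.inl i) * q)
    have h3 := integrable_ev (ι := ι) v (MvPolynomial.pderiv (Sum.inr i) p)
    have h4 := integrable_ev (ι := ι) v (MvPolynomial.pderiv (Sum.inr i) q)
    simp only [ev, mul_add, map_add] at *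
    rw [integral_add h1 h2, integral_add h3 h4, hp, hq]
    ring

/-- the quadratic form as polynomial -/
noncomputable def Lp (A : Matrix ι ι ℂ) (i : ι) : MvPolynomial (ι ⊕ ι) ℂ :=
  ∑ j, MvPolynomial.C (A i j) * MvPolynomial.X (Sum.inr j)

noncomputable def Qp (A : Matrix ι ι ℂ) : MvPolynomial (ι ⊕ ι) ℂ :=
  ∑ i, MvPolynomial.X (Sum.inl i) * Lp A i

/-- the quadratic form -/
noncomputable def qf (A : Matrix ι ι ℂ) (z : ι → ℂ) : ℂ := z ⬝ᵥ (A *ᵥ (star z))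

lemma ev_Qp (A : Matrix ι ι ℂ) (z : ι → ℂ) : ev z (Qp A) = qf A z := by
  simp [ev, Qp, Lp, qf, dotProduct, mulVec, map_sum, map_mul]

lemma pderiv_Lp (A : Matrix ι ι ℂ) (i k : ι) :
    MvPolynomial.pderiv (Sum.inr k) (Lp A i) = MvPolynomial.C (A i k) := by
  simp [Lp, MvPolynomial.pderiv_X, Pi.single_apply, MvPolynomial.pderiv_mul, MvPolynomial.pderiv_C]

lemma pderiv_Qp (A : Matrix ι ι ℂ) (k : ι) :
    MvPolynomial.pderiv (Sum.inr k) (Qp A) =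
      ∑ i, MvPolynomial.X (Sum.inl i) * MvPolynomial.C (A i k) := by
  simp [Qp, MvPolynomial.pderiv_mul, pderiv_Lp, MvPolynomial.pderiv_X]

lemma sum_Lp_pderiv (A : Matrix ι ι ℂ) :
    ∑ k, Lp A k * MvPolynomial.pderiv (Sum.inr k) (Qp A) = Qp (A * A) := by
  simp only [pderiv_Qp]
  simp only [Qp, Lp, Matrix.mul_apply, map_sum, map_mul, Finset.mul_sum, Finset.sum_mul]
  rw [Finset.sum_comm]
  refine Finset.sum_congr rfl fun i _ => ?_
  rw [Finset.sum_comm]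
  refine Finset.sum_congr rfl fun j _ => Finset.sum_congr rfl fun k _ => ?_
  ring

lemma qf_rec {v : ℝ≥0} (hv : v ≠ 0) (A : Matrix ι ι ℂ) (q : ℕ) :
    ∫ z, qf A z ^ (q + 1) ∂(Measure.pi fun _ => complexGaussian v) =
      v * A.trace * ∫ z, qf A z ^ q ∂(Measure.pi fun _ => complexGaussian v) +
      v * q * ∫ z, qf (A * A) z * qf A z ^ (q - 1) ∂(Measure.pi fun _ => complexGaussian v) := by
  have e0 : ∀ z : ι → ℂ, qf A z ^ (q + 1) =
      ∑ i, ev z (MvPolynomial.X (Sum.inl i) * (Lp A i * Qp A ^ q)) := by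
    intro z
    rw [← ev_Qp]
    simp only [ev, ← map_pow, ← map_sum]
    congr 1
    simp only [← mul_assoc, ← Finset.sum_mul]
    rw [pow_succ']
    rfl
  have e1 : ∀ i, ∫ z, ev z (MvPolynomial.X (Sum.inl i) * (Lp A i * Qp A ^ q))
        ∂(Measure.pi fun _ => complexGaussian v) =
      v * (A i i * ∫ z, ev z (Qp A ^ q) ∂(Measure.pi fun _ => complexGaussian v) +
       q * ∫ z, ev z (Lp A i * MvPolynomial.pderiv (Sum.inr i) (Qp A) * Qp A ^ (q - 1))
        ∂(Measure.pi fun _ => complexGaussian v)) := by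
    intro i
    rw [wick hv, MvPolynomial.pderiv_mul, pderiv_Lp, MvPolynomial.pderiv_pow]
    have h1 := (integrable_ev v (Qp A ^ q)).const_mul (A i i)
    have h2 := (integrable_ev v (Lp A i * MvPolynomial.pderiv (Sum.inr i) (Qp A) *
      Qp A ^ (q - 1))).const_mul (q : ℂ)
    rw [← integral_const_mul (A i i), ← integral_const_mul (q : ℂ), ← integral_add h1 h2]
    congr 2
    funext z
    simp only [ev, map_add, map_mul, map_pow, MvPolynomial.eval_C, map_natCast]
    ring
  simp only [e0]
  rw [integral_finsetSum _ (fun i _ => integrable_ev v _)]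
  simp only [e1]
  rw [← Finset.mul_sum, Finset.sum_add_distrib, ← Finset.sum_mul, ← Finset.mul_sum,
    ← integral_finsetSum _ (fun i _ => integrable_ev v _)]
  have e2 : ∀ z, ∑ i, ev z (Lp A i * MvPolynomial.pderiv (Sum.inr i) (Qp A) * Qp A ^ (q - 1)) =
      qf (A * A) z * qf A z ^ (q - 1) := by
    intro z
    rw [← ev_Qp, ← ev_Qp, ← sum_Lp_pderiv]
    simp [ev, map_sum, map_mul, Finset.sum_mul]
  have e3 : ∀ z, ev z (Qp A ^ q) = qf A z ^ q := by
    intro z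
    rw [← ev_Qp]; simp [ev]
  simp only [e2, e3, Matrix.trace, Matrix.diag]
  ring

lemma integrable_qf (v : ℝ≥0) (A B : Matrix ι ι ℂ) (q r : ℕ) :
    Integrable (fun z => qf A z ^ q * qf B z ^ r) (Measure.pi fun _ => complexGaussian v) := by
  refine (integrable_ev v (Qp A ^ q * Qp B ^ r)).congr ?_
  filter_upwards with z
  rw [← ev_Qp, ← ev_Qp]; simp [ev]

lemma qf_mean {v : ℝ≥0} (hv : v ≠ 0) (A : Matrix ι ι ℂ) :
    ∫ z, qf A z ∂(Measure.pi fun _ => complexGaussian v) = v * A.trace := by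
  simpa using qf_rec hv A 0

lemma qf_sq {v : ℝ≥0} (hv : v ≠ 0) (A : Matrix ι ι ℂ) :
    ∫ z, qf A z ^ 2 ∂(Measure.pi fun _ => complexGaussian v) =
      (v * A.trace) ^ 2 + v ^ 2 * (A * A).trace := by
  have := qf_rec hv A 1
  simp only [pow_one, qf_mean hv, Nat.sub_self, pow_zero, mul_one] at this
  rw [this]; push_cast; ring

lemma qf_var {v : ℝ≥0} (hv : v ≠ 0) (A : Matrix ι ι ℂ) :
    ∫ z, (qf A z - v * A.trace) ^ 2 ∂(Measure.pi fun _ => complexGaussian v) =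
      v ^ 2 * (A * A).trace := by
  have h2 : Integrable (fun z => qf A z ^ 2) (Measure.pi fun _ => complexGaussian v) := by
    simpa using integrable_qf v A A 2 0
  have h1 : Integrable (fun z => 2 * (v * A.trace) * qf A z)
      (Measure.pi fun _ => complexGaussian v) := by
    simpa using (integrable_qf v A A 1 0).const_mul (2 * (v * A.trace))
  have h0 : Integrable (fun _ : ι → ℂ => (v * A.trace) ^ 2)
      (Measure.pi fun _ => complexGaussian v) := integrable_const _
  have : ∀ z, (qf A z - v * A.trace) ^ 2 =
      (qf A z ^ 2 - 2 * (v * A.trace) * qf A z) + (v * A.trace) ^ 2 := by intro z; ring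
  simp only [this]
  have h3 := h2.sub h1
  simp only [Pi.sub_def] at h3
  rw [integral_add h3 h0, integral_sub h2 h1, integral_const_mul, qf_sq hv, qf_mean hv]
  simp
  ring

end quad
end GTaux

namespace GTaux
section quad2
open scoped ComplexOrder
variable {ι : Type*} [Fintype ι] [DecidableEq ι]

lemma qf_nonneg {A : Matrix ι ι ℂ} (hA : A.PosSemidef) (z : ι → ℂ) : 0 ≤ qf A z := by
  have := hA.dotProduct_mulVec_nonneg (star z)
  simpa [qf] using this

lemma psd_mul_self {A : Matrix ι ι ℂ} (hA : A.PosSemidef) : (A * A).PosSemidef := by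
  have := hA.pow 2
  rwa [pow_two] at this

lemma eq_ofReal_of_nonneg {w : ℂ} (h : 0 ≤ w) : w = ((‖w‖ : ℝ) : ℂ) :=
  (Complex.norm_of_nonneg' h).symm

lemma qf_mul_self_le {A : Matrix ι ι ℂ} (hA : A.PosSemidef) (z : ι → ℂ) :
    ‖qf (A * A) z‖ ≤ ‖A.trace‖ * ‖qf A z‖ := by
  obtain ⟨B, hB⟩ := (by
    open scoped MatrixOrder in
    exact CStarAlgebra.nonneg_iff_eq_star_mul_self.mp hA.nonneg :
      ∃ B : Matrix ι ι ℂ, A = Bᴴ * B)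
  subst hB
  set y := B *ᵥ star z with hy
  have h1 : qf (Bᴴ * B) z = star y ⬝ᵥ y := by
    simp only [qf, hy, ← Matrix.mulVec_mulVec, Matrix.star_mulVec, star_star, Matrix.dotProduct_mulVec]
  have h2 : qf (Bᴴ * B * (Bᴴ * B)) z = star (Bᴴ *ᵥ y) ⬝ᵥ (Bᴴ *ᵥ y) := by
    simp only [qf, hy, ← Matrix.mulVec_mulVec, Matrix.star_mulVec, star_star,
      Matrix.dotProduct_mulVec, conjTranspose_conjTranspose]
  have h3 : ∀ x : ι → ℂ, star x ⬝ᵥ x = ((∑ i, ‖x i‖ ^ 2 : ℝ) : ℂ) := by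
    intro x
    simp only [dotProduct, Pi.star_apply]
    push_cast
    refine Finset.sum_congr rfl fun i _ => ?_
    rw [Complex.star_def, Complex.conj_mul']
  have h4 : (Bᴴ * B).trace = ((∑ i, ∑ j, ‖B j i‖ ^ 2 : ℝ) : ℂ) := by
    simp only [Matrix.trace, Matrix.diag, Matrix.mul_apply, conjTranspose_apply]
    push_cast
    refine Finset.sum_congr rfl fun i _ => Finset.sum_congr rfl fun j _ => ?_
    rw [Complex.star_def, Complex.conj_mul']
  rw [h1, h2, h3, h3, h4, Complex.norm_real, Complex.norm_real, Complex.norm_real,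
    Real.norm_of_nonneg (by positivity), Real.norm_of_nonneg (by positivity),
    Real.norm_of_nonneg (by positivity), Finset.sum_mul]
  refine Finset.sum_le_sum fun i _ => ?_
  have h5 : ‖(Bᴴ *ᵥ y) i‖ ≤ ∑ j, ‖B j i‖ * ‖y j‖ := by
    simp only [mulVec, dotProduct, conjTranspose_apply]
    refine (norm_sum_le _ _).trans (Finset.sum_le_sum fun j _ => ?_)
    rw [norm_mul, norm_star]
  calc _ ≤ (∑ j, ‖B j i‖ * ‖y j‖) ^ 2 := by gcongr
    _ ≤ _ := Finset.sum_mul_sq_le_sq_mul_sq _ _ _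

lemma qf_moment_real {v : ℝ≥0} (hv : v ≠ 0) {A : Matrix ι ι ℂ} (hA : A.PosSemidef) (q : ℕ) :
    ∫ z, ‖qf A z‖ ^ q ∂(Measure.pi fun _ => complexGaussian v) ≤ q.factorial * (v * ‖A.trace‖) ^ q := by
  induction q with
  | zero => simp
  | succ q ih =>
    set μ : Measure (ι → ℂ) := Measure.pi fun _ => complexGaussian v with hμ
    have hI : ∀ B : Matrix ι ι ℂ, ∀ a b : ℕ, Integrable (fun z => ‖qf A z‖ ^ a * ‖qf B z‖ ^ b) μ := by
      intro B a b
      simpa using (integrable_qf v A B a b).norm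
    have h := qf_rec hv A q
    have e1 : ∀ (z : ι → ℂ) , qf A z = ((‖qf A z‖ : ℝ) : ℂ) :=
      fun z => eq_ofReal_of_nonneg (qf_nonneg hA z)
    have e2 : ∀ (z : ι → ℂ) , qf (A * A) z = ((‖qf (A * A) z‖ : ℝ) : ℂ) :=
      fun z => eq_ofReal_of_nonneg (qf_nonneg (psd_mul_self hA) z)
    have e3 : ∀ (z : ι → ℂ) (k : ℕ), qf A z ^ k = ((‖qf A z‖ ^ k : ℝ) : ℂ) := by
      intro z k; push_cast; rw [← e1]
    have e4 : ∀ (z : ι → ℂ) (k : ℕ), qf (A * A) z * qf A z ^ k =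
        ((‖qf A z‖ ^ k * ‖qf (A * A) z‖ : ℝ) : ℂ) := by
      intro z k; push_cast; rw [← e1, ← e2]; ring
    have e5 : A.trace = ((‖A.trace‖ : ℝ) : ℂ) := eq_ofReal_of_nonneg hA.trace_nonneg
    simp only [e4] at h
    simp only [e3] at h
    rw [e5, integral_complex_ofReal, integral_complex_ofReal, integral_complex_ofReal] at h
    have h' : ∫ z, ‖qf A z‖ ^ (q + 1) ∂μ = v * ‖A.trace‖ * ∫ z, ‖qf A z‖ ^ q ∂μ +
      v * q * ∫ z, ‖qf A z‖ ^ (q - 1) * ‖qf (A * A) z‖ ∂μ := by exact_mod_cast h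
    have h6 : q * ∫ z, ‖qf A z‖ ^ (q - 1) * ‖qf (A * A) z‖ ∂μ ≤
        q * (‖A.trace‖ * ∫ z, ‖qf A z‖ ^ q ∂μ) := by
      rcases q with _ | q
      · simp
      · gcongr
        rw [← integral_const_mul]
        refine MeasureTheory.integral_mono ?_ ?_ ?_
        · simpa using hI (A * A) q 1
        · simpa using (hI A (q + 1) 0).const_mul _
        · intro z
          simp only [Nat.add_sub_cancel]
          calc ‖qf A z‖ ^ q * ‖qf (A * A) z‖ ≤ ‖qf A z‖ ^ q * (‖A.trace‖ * ‖qf A z‖) := by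
                gcongr; exact qf_mul_self_le hA z
            _ = _ := by ring
    rw [h']
    calc _ = v * ‖A.trace‖ * ∫ z, ‖qf A z‖ ^ q ∂μ +
          v * (q * ∫ z, ‖qf A z‖ ^ (q - 1) * ‖qf (A * A) z‖ ∂μ) := by ring
      _ ≤ v * ‖A.trace‖ * ∫ z, ‖qf A z‖ ^ q ∂μ +
          v * (q * (‖A.trace‖ * ∫ z, ‖qf A z‖ ^ q ∂μ)) := by gcongr
      _ = (q + 1) * (v * ‖A.trace‖) * ∫ z, ‖qf A z‖ ^ q ∂μ := by ring
      _ ≤ (q + 1) * (v * ‖A.trace‖) * (q.factorial * (v * ‖A.trace‖) ^ q) := by gcongr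
      _ = _ := by rw [Nat.factorial_succ]; push_cast; ring

lemma qf_moment {v : ℝ≥0} (hv : v ≠ 0) {A : Matrix ι ι ℂ} (hA : A.PosSemidef) (q : ℕ) :
    ∫⁻ z, ‖qf A z‖ₑ ^ q ∂(Measure.pi fun _ => complexGaussian v) ≤
      q.factorial * ‖(v : ℂ) * A.trace‖ₑ ^ q := by
  have hI : Integrable (fun z => ‖qf A z‖ ^ q) (Measure.pi fun _ => complexGaussian v) := by
    simpa using (integrable_qf v A A q 0).norm
  have h := ENNReal.ofReal_le_ofReal (qf_moment_real hv hA q)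
  rw [ofReal_integral_eq_lintegral_ofReal hI (by filter_upwards with z; positivity)] at h
  convert h using 1
  · congr 1; funext z
    rw [ENNReal.ofReal_pow (by positivity), ofReal_norm]
  · rw [ENNReal.ofReal_mul (by positivity), ENNReal.ofReal_pow (by positivity), ENNReal.ofReal_natCast,
      ← ofReal_norm, norm_mul]
    simp

lemma qf_var_enorm {v : ℝ≥0} (hv : v ≠ 0) {A : Matrix ι ι ℂ} (hA : A.PosSemidef) :
    ∫⁻ z, ‖qf A z - v * A.trace‖ₑ ^ 2 ∂(Measure.pi fun _ => complexGaussian v) =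
      ‖(v : ℂ) ^ 2 * (A * A).trace‖ₑ := by
  have e1 : ∀ (z : ι → ℂ) , qf A z = ((‖qf A z‖ : ℝ) : ℂ) :=
      fun z => eq_ofReal_of_nonneg (qf_nonneg hA z)
  have e5 : A.trace = ((‖A.trace‖ : ℝ) : ℂ) := eq_ofReal_of_nonneg hA.trace_nonneg
  have e6 : (A * A).trace = ((‖(A * A).trace‖ : ℝ) : ℂ) :=
    eq_ofReal_of_nonneg (psd_mul_self hA).trace_nonneg
  have e7 : ∀ z, (qf A z - v * A.trace) = ((‖qf A z‖ - v * ‖A.trace‖ : ℝ) : ℂ) := by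
    intro z; push_cast; rw [← e1, ← e5]
  have e8 : ∀ z, (qf A z - v * A.trace) ^ 2 = ((‖qf A z - v * A.trace‖ ^ 2 : ℝ) : ℂ) := by
    intro z
    rw [e7, Complex.norm_real, Real.norm_eq_abs, sq_abs]; push_cast; rfl
  have hI : Integrable (fun z => ‖qf A z - v * A.trace‖ ^ 2) (Measure.pi fun _ => complexGaussian v) := by
    have h2 : Integrable (fun z => qf A z ^ 2) (Measure.pi fun _ => complexGaussian v) := by
      simpa using integrable_qf v A A 2 0
    have h1 : Integrable (fun z => 2 * (v * A.trace) * qf A z)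
        (Measure.pi fun _ => complexGaussian v) := by
      simpa using (integrable_qf v A A 1 0).const_mul (2 * (v * A.trace))
    have h0 : Integrable (fun _ : ι → ℂ => (v * A.trace) ^ 2)
      (Measure.pi fun _ => complexGaussian v) := integrable_const _
    refine ((h2.sub h1).add h0).norm.congr ?_
    filter_upwards with z
    simp only [Pi.add_apply, Pi.sub_apply]
    rw [← norm_pow]
    congr 1
    ring
  have h := qf_var hv A
  simp only [e8] at h
  rw [integral_complex_ofReal] at h
  rw [← h, ← ofReal_norm, Complex.norm_real, Real.norm_of_nonneg (by positivity),
    ofReal_integral_eq_lintegral_ofReal hI (by filter_upwards with z; positivity)]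
  congr 1; funext z
  rw [ENNReal.ofReal_pow (by positivity), ofReal_norm]

end quad2
end GTaux

namespace GTaux
section abel

lemma findiff (n : ℕ) : ∑ k ∈ Finset.range (n + 2),
    ((-1 : ℂ) ^ (n + 1 - k) * ((n + 1).choose k : ℂ)) * ((k : ℂ) + 1) ^ n = 0 := by
  have h1 := fwdDiff_iter_eq_sum_shift (h := (1 : ℂ)) (fun x : ℂ => x ^ n) (n + 1) 1
  have h2 := fwdDiff_iter_pow_eq_zero_of_lt (R := ℂ) (Nat.lt_succ_self n)
  rw [h2] at h1
  simp only [Pi.zero_apply, zsmul_eq_mul] at h1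
  rw [h1]
  refine Finset.sum_congr rfl fun k _ => ?_
  push_cast
  simp [add_comm]

open Polynomial in
lemma abel_poly (n : ℕ) :
    ∑ k ∈ Finset.range (n + 1), C (((n.choose k : ℂ)) * ((k : ℂ) + 1) ^ (k - 1)) *
      (X + C ((n - k : ℕ) : ℂ)) ^ (n - k) = (X + C ((n : ℂ) + 1)) ^ n := by
  induction n with
  | zero => simp
  | succ n ih =>
    rw [← sub_eq_zero]
    set F : ℂ[X] := ∑ k ∈ Finset.range (n + 1 + 1),
      C ((((n + 1).choose k : ℂ)) * ((k : ℂ) + 1) ^ (k - 1)) *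
      (X + C ((n + 1 - k : ℕ) : ℂ)) ^ (n + 1 - k) with hF
    have hd : derivative (F - (X + C (((n + 1 : ℕ) : ℂ) + 1)) ^ (n + 1)) = 0 := by
      have ih2 := congrArg (fun p => C ((n : ℂ) + 1) * p.comp (X + C 1)) ih
      simp only [Polynomial.sum_comp, mul_comp, C_comp, pow_comp, add_comp, X_comp] at ih2
      rw [derivative_sub, sub_eq_zero, derivative_pow]
      have e1 : C ((n : ℂ) + 1) * (X + C 1 + C ((n : ℂ) + 1)) ^ n =
        C (((n + 1 : ℕ) : ℂ)) * (X + C (((n + 1 : ℕ) : ℂ) + 1)) ^ (n + 1 - 1) *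
        derivative (X + C (((n + 1 : ℕ) : ℂ) + 1)) := by
        simp only [Nat.add_sub_cancel, derivative_add, derivative_X, derivative_C, add_zero, mul_one]
        push_cast
        simp only [map_add, map_natCast, map_one]
        ring
      rw [← e1, ← ih2, hF, derivative_sum, Finset.sum_range_succ, Finset.mul_sum]
      have e2 : derivative (C ((((n + 1).choose (n + 1) : ℂ)) * (((n + 1 : ℕ) : ℂ) + 1) ^ ((n + 1) - 1)) *
        (X + C ((n + 1 - (n + 1) : ℕ) : ℂ)) ^ (n + 1 - (n + 1))) = 0 := by
        rw [Nat.sub_self, pow_zero, mul_one, derivative_C]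
      rw [e2, add_zero]
      refine Finset.sum_congr rfl fun k hk => ?_
      have hk' : k ≤ n := by simpa [Nat.lt_succ_iff] using hk
      obtain ⟨m, rfl⟩ := Nat.exists_eq_add_of_le hk'
      have e3 : k + m + 1 - k = m + 1 := by omega
      have e4 : k + m - k = m := by omega
      have e5 := Nat.choose_mul_succ_eq (k + m) k
      rw [e3] at e5
      have e6 : (((k + m).choose k : ℂ)) * ((k + m : ℕ) + 1) = ((k + m + 1).choose k) * (m + 1) := by
        exact_mod_cast e5
      rw [e3, e4]
      simp only [derivative_mul, derivative_C, zero_mul, zero_add, derivative_pow, derivative_add,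
        derivative_X, add_zero, mul_one, Nat.add_sub_cancel]
      have e7 : (X + C ((m + 1 : ℕ) : ℂ)) = (X + C 1 + C (m : ℂ)) := by
        push_cast; simp only [map_add, map_one]; ring
      rw [e7, ← mul_assoc, ← mul_assoc, ← C_mul, ← C_mul]
      congr 2
      push_cast at e6 ⊢
      linear_combination (-((k : ℂ) + 1) ^ (k - 1)) * e6
    have hc := Polynomial.eq_C_of_derivative_eq_zero hd
    have hz : (F - (X + C (((n + 1 : ℕ) : ℂ) + 1)) ^ (n + 1)).eval (-(((n + 1 : ℕ) : ℂ) + 1)) = 0 := by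
      simp only [hF, eval_sub, eval_finsetSum, eval_mul, eval_C, eval_pow, eval_add, eval_X,
        neg_add_cancel, zero_pow (Nat.succ_ne_zero n), sub_zero]
      rw [← findiff n]
      refine Finset.sum_congr rfl fun k hk => ?_
      have hk' : k ≤ n + 1 := by simpa [Nat.lt_succ_iff] using hk
      have e1 : -(((n + 1 : ℕ) : ℂ) + 1) + ((n + 1 - k : ℕ) : ℂ) = (-1) * ((k : ℂ) + 1) := by
        push_cast [hk']; ring
      rw [e1, mul_pow]
      rcases k with _ | k
      · simp
      · have : ((((k + 1 : ℕ) : ℂ)) + 1) ^ n = (((k + 1 : ℕ) : ℂ) + 1) ^ (k + 1 - 1) *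
            (((k + 1 : ℕ) : ℂ) + 1) ^ (n + 1 - (k + 1)) := by
          rw [← pow_add]; congr 1; omega
        rw [this]; ring
    rw [hc, eval_C] at hz
    rw [hc, hz, C_0]

lemma abel_eval (n : ℕ) (y : ℂ) :
    ∑ k ∈ Finset.range (n + 1), ((n.choose k : ℂ)) * ((k : ℂ) + 1) ^ (k - 1) *
      (y + ((n - k : ℕ) : ℂ)) ^ (n - k) = (y + n + 1) ^ n := by
  have := congrArg (Polynomial.eval y) (abel_poly n)
  simpa [Polynomial.eval_finsetSum, add_assoc] using this

noncomputable def cc (k : ℕ) : ℂ := (k : ℂ) ^ k / ((k + 1).factorial : ℂ)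
noncomputable def ee (k : ℕ) : ℂ := ((k : ℂ) + 1) ^ (k - 1) / (k.factorial : ℂ)
noncomputable def qq (k : ℕ) : ℂ := ee (k + 1)

lemma choose_div (n k : ℕ) (h : k ≤ n) :
    (n.choose k : ℂ) / (n.factorial : ℂ) = 1 / (k.factorial : ℂ) / ((n - k).factorial : ℂ) := by
  have := Nat.choose_mul_factorial_mul_factorial h
  have h' : (n.choose k : ℂ) * k.factorial * (n - k).factorial = n.factorial := by exact_mod_cast this
  have h1 : (k.factorial : ℂ) ≠ 0 := by exact_mod_cast k.factorial_ne_zero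
  have h2 : ((n - k).factorial : ℂ) ≠ 0 := by exact_mod_cast (n - k).factorial_ne_zero
  have h3 : (n.factorial : ℂ) ≠ 0 := by exact_mod_cast n.factorial_ne_zero
  field_simp
  linear_combination h'

lemma abel_b (n : ℕ) : ∑ k ∈ Finset.range (n + 1), ee k * (((n - k : ℕ) : ℂ) + 1) * cc (n - k) =
    ((n : ℂ) + 1) ^ n / n.factorial := by
  have := abel_eval n 0
  simp only [zero_add] at this
  rw [← this, Finset.sum_div]
  refine Finset.sum_congr rfl fun k hk => ?_
  have hk' : k ≤ n := by simpa [Nat.lt_succ_iff] using hk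
  have := choose_div n k hk'
  have h2 : ((n - k).factorial : ℂ) ≠ 0 := by exact_mod_cast (n - k).factorial_ne_zero
  have h4 : (((n - k : ℕ) : ℂ) + 1) ≠ 0 := by exact_mod_cast (Nat.succ_ne_zero (n - k))
  calc _ = (1 / (k.factorial : ℂ) / ((n - k).factorial : ℂ)) * ((k : ℂ) + 1) ^ (k - 1) * ((n - k : ℕ) : ℂ) ^ (n - k) := by
        unfold ee cc
        rw [Nat.factorial_succ]; push_cast
        field_simp
    _ = _ := by rw [← this]; ring

lemma abel_a (n : ℕ) : ee (n + 1) = ∑ k ∈ Finset.range (n + 1), ee k * cc (n - k) := by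
  have h1 := abel_eval (n + 1) (-1)
  have h2 := abel_eval n 0
  simp only [zero_add] at h2
  have h5 : ((n + 1).factorial : ℂ) ≠ 0 := by exact_mod_cast (n + 1).factorial_ne_zero
  have h3 : ∑ k ∈ Finset.range (n + 1), ((n + 1).choose k : ℂ) * ((k : ℂ) + 1) ^ (k - 1) *
      ((n - k : ℕ) : ℂ) ^ (n - k) = ((n : ℂ) + 2) ^ n := by
    have h4 : ∀ k ∈ Finset.range (n + 1), ((n + 1).choose k : ℂ) * ((k : ℂ) + 1) ^ (k - 1) *
      ((n - k : ℕ) : ℂ) ^ (n - k) = ((n + 1 : ℕ) : ℂ) * (((n.choose k : ℂ)) * ((k : ℂ) + 1) ^ (k - 1) *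
      (((n - k : ℕ) : ℂ)) ^ (n - k)) - ((n + 1).choose k : ℂ) * ((k : ℂ) + 1) ^ (k - 1) *
      (-1 + ((n + 1 - k : ℕ) : ℂ)) ^ (n + 1 - k) := by
      intro k hk
      have hk' : k ≤ n := by simpa [Nat.lt_succ_iff] using hk
      obtain ⟨m, rfl⟩ := Nat.exists_eq_add_of_le hk'
      have e3 : k + m + 1 - k = m + 1 := by omega
      have e4 : k + m - k = m := by omega
      have e5 := Nat.choose_mul_succ_eq (k + m) k
      rw [e3] at e5
      have e6 : (((k + m).choose k : ℂ)) * ((k + m : ℕ) + 1) = ((k + m + 1).choose k) * (m + 1) := by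
        exact_mod_cast e5
      rw [e3, e4]
      push_cast at e6 ⊢
      have e8 : (-1 + ((m : ℂ) + 1)) = m := by ring
      rw [e8]
      linear_combination (-((k : ℂ) + 1) ^ (k - 1) * (m : ℂ) ^ m) * e6
    rw [Finset.sum_congr rfl h4, Finset.sum_sub_distrib, ← Finset.mul_sum, h2]
    rw [Finset.sum_range_succ] at h1
    simp only [Nat.choose_self, Nat.sub_self, pow_zero, Nat.add_sub_cancel] at h1
    push_cast at h1 ⊢
    have e9 : (-1 + ((n : ℂ) + 1) + 1) = n + 1 := by ring
    rw [e9] at h1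
    linear_combination (-1 : ℂ) * h1
  have h6 : ee (n + 1) = ((n : ℂ) + 2) ^ n / (n + 1).factorial := by
    unfold ee
    simp only [Nat.add_sub_cancel]
    push_cast
    congr 2
    ring
  rw [h6, ← h3, Finset.sum_div]
  refine Finset.sum_congr rfl fun k hk => ?_
  have hk' : k ≤ n := by simpa [Nat.lt_succ_iff] using hk
  have := choose_div (n + 1) k (by omega)
  have e3 : n + 1 - k = (n - k) + 1 := by omega
  rw [e3] at this
  calc _ = (((n + 1).choose k : ℂ) / ((n + 1).factorial : ℂ)) * (((k : ℂ) + 1) ^ (k - 1) * ((n - k : ℕ) : ℂ) ^ (n - k)) := by ring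
    _ = _ := by
        rw [this]; unfold ee cc; ring

lemma qq_rec (k : ℕ) : qq k = cc k + ∑ i ∈ Finset.range k, cc i * qq (k - 1 - i) := by
  unfold qq
  rw [abel_a, ← Finset.sum_range_reflect, Finset.sum_range_succ, add_comm]
  congr 1
  · simp [ee]
  · refine Finset.sum_congr rfl fun i hi => ?_
    have : i < k := by simpa using hi
    rw [mul_comm]
    congr 2 <;> omega

lemma dd_rec (P : ℕ) : ((P : ℂ) + 1) * cc P + ∑ j ∈ Finset.range P,
    ((P - j : ℕ) : ℂ) * cc (P - 1 - j) * qq j = ((P : ℂ) + 1) ^ P / P.factorial := by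
  rw [← abel_b, Finset.sum_range_succ', add_comm]
  congr 1
  · refine Finset.sum_congr rfl fun i hi => ?_
    have : i < P := by simpa using hi
    obtain ⟨m, rfl⟩ := Nat.exists_eq_add_of_lt this
    have e1 : i + m + 1 - i = m + 1 := by omega
    have e2 : i + m + 1 - 1 - i = m := by omega
    have e3 : i + m + 1 - (i + 1) = m := by omega
    rw [e1, e2, e3]
    unfold qq
    push_cast; ring
  · simp [ee]

end abel
end GTaux

namespace GTaux
section rankone
variable {ι : Type*} [Fintype ι] [DecidableEq ι]

lemma bil_rank_one (B C : Matrix ι ι ℂ) (u w : ι → ℂ) :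
    w ⬝ᵥ ((B * vecMulVec u w * C) *ᵥ u) = (w ⬝ᵥ (B *ᵥ u)) * (w ⬝ᵥ (C *ᵥ u)) := by
  rw [Matrix.mul_assoc, ← Matrix.mulVec_mulVec, ← Matrix.mulVec_mulVec]
  have : vecMulVec u w *ᵥ (C *ᵥ u) = (w ⬝ᵥ (C *ᵥ u)) • u := by
    rw [Matrix.vecMulVec_mulVec]; simp
  rw [this, Matrix.mulVec_smul, dotProduct_smul, smul_eq_mul, mul_comm]

lemma trace_rank_one (B C : Matrix ι ι ℂ) (u w : ι → ℂ) :
    (B * vecMulVec u w * C).trace = w ⬝ᵥ ((C * B) *ᵥ u) := by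
  rw [Matrix.trace_mul_comm, ← Matrix.mul_assoc, Matrix.mul_vecMulVec, Matrix.trace_vecMulVec,
    dotProduct_comm]

lemma e_rec (S : Matrix ι ι ℂ) (u w : ι → ℂ) (b a : ℕ) :
    w ⬝ᵥ ((S ^ b * (S + vecMulVec u w) ^ a) *ᵥ u) = w ⬝ᵥ (S ^ (b + a) *ᵥ u) +
      ∑ i ∈ Finset.range a, (w ⬝ᵥ (S ^ (b + i) *ᵥ u)) *
        (w ⬝ᵥ ((S + vecMulVec u w) ^ (a - 1 - i) *ᵥ u)) := by
  induction a generalizing b with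
  | zero => simp
  | succ a ih =>
    have : S ^ b * (S + vecMulVec u w) ^ (a + 1) = S ^ (b + 1) * (S + vecMulVec u w) ^ a +
        S ^ b * vecMulVec u w * (S + vecMulVec u w) ^ a := by
      rw [pow_succ' (S + vecMulVec u w), ← mul_assoc, mul_add, add_mul, pow_succ]
    rw [this, Matrix.add_mulVec, dotProduct_add, bil_rank_one, ih, Finset.sum_range_succ', add_assoc]
    congr 1
    · congr 3; omega
    · congr 1
      refine Finset.sum_congr rfl fun i _ => ?_
      congr 4 <;> omega

lemma trace_rec (S : Matrix ι ι ℂ) (u w : ι → ℂ) (b p : ℕ) :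
    (S ^ b * (S + vecMulVec u w) ^ p).trace = (S ^ (b + p)).trace +
      ∑ i ∈ Finset.range p, w ⬝ᵥ (((S + vecMulVec u w) ^ (p - 1 - i) * S ^ (b + i)) *ᵥ u) := by
  induction p generalizing b with
  | zero => simp
  | succ a ih =>
    have : S ^ b * (S + vecMulVec u w) ^ (a + 1) = S ^ (b + 1) * (S + vecMulVec u w) ^ a +
        S ^ b * vecMulVec u w * (S + vecMulVec u w) ^ a := by
      rw [pow_succ' (S + vecMulVec u w), ← mul_assoc, mul_add, add_mul, pow_succ]
    rw [this, Matrix.trace_add, trace_rank_one, ih, Finset.sum_range_succ', add_assoc]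
    congr 1
    · congr 2; omega
    · congr 1
      refine Finset.sum_congr rfl fun i _ => ?_
      congr 4 <;> omega

lemma e_rec' (S : Matrix ι ι ℂ) (u w : ι → ℂ) (b a : ℕ) :
    w ⬝ᵥ (((S + vecMulVec u w) ^ a * S ^ b) *ᵥ u) = w ⬝ᵥ (S ^ (b + a) *ᵥ u) +
      ∑ i ∈ Finset.range a, (w ⬝ᵥ (S ^ (b + i) *ᵥ u)) *
        (w ⬝ᵥ ((S + vecMulVec u w) ^ (a - 1 - i) *ᵥ u)) := by
  induction a generalizing b with
  | zero => simp
  | succ a ih =>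
    have : (S + vecMulVec u w) ^ (a + 1) * S ^ b = (S + vecMulVec u w) ^ a * S ^ (b + 1) +
        (S + vecMulVec u w) ^ a * vecMulVec u w * S ^ b := by
      rw [pow_succ (S + vecMulVec u w), mul_assoc, add_mul, mul_add, pow_succ', mul_assoc]
    rw [this, Matrix.add_mulVec, dotProduct_add, bil_rank_one, ih, Finset.sum_range_succ', add_assoc]
    congr 1
    · congr 3; omega
    · congr 1
      · refine Finset.sum_congr rfl fun i _ => ?_
        congr 4 <;> omega
      · rw [mul_comm]; rfl

lemma q_rec (S : Matrix ι ι ℂ) (u w : ι → ℂ) (k : ℕ) :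
    w ⬝ᵥ ((S + vecMulVec u w) ^ k *ᵥ u) = w ⬝ᵥ (S ^ k *ᵥ u) +
      ∑ i ∈ Finset.range k, (w ⬝ᵥ (S ^ i *ᵥ u)) *
        (w ⬝ᵥ ((S + vecMulVec u w) ^ (k - 1 - i) *ᵥ u)) := by
  simpa using e_rec S u w 0 k

lemma D_rec (S : Matrix ι ι ℂ) (u w : ι → ℂ) (P : ℕ) :
    ((S + vecMulVec u w) ^ (P + 1)).trace = (S ^ (P + 1)).trace +
      (((P : ℂ) + 1) * (w ⬝ᵥ (S ^ P *ᵥ u)) +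
      ∑ m ∈ Finset.range P, ((m : ℂ) + 1) * ((w ⬝ᵥ (S ^ m *ᵥ u)) *
        (w ⬝ᵥ ((S + vecMulVec u w) ^ (P - 1 - m) *ᵥ u)))) := by
  have h := trace_rec S u w 0 (P + 1)
  simp only [pow_zero, one_mul, zero_add, e_rec'] at h
  rw [h, Finset.sum_add_distrib]
  congr 2
  · rw [Finset.sum_congr rfl (g := fun _ => w ⬝ᵥ (S ^ P *ᵥ u))]
    · simp
    · intro i hi
      have : i ≤ P := by simpa [Nat.lt_succ_iff] using hi
      congr 3; omega
  · have h2 := Finset.sum_range_diag_flip P (fun i l => (w ⬝ᵥ (S ^ (i + l) *ᵥ u)) *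
        (w ⬝ᵥ ((S + vecMulVec u w) ^ (P - 1 - (i + l)) *ᵥ u)))
    rw [Finset.sum_range_succ]
    simp only [Nat.add_sub_cancel, Nat.sub_self, Finset.range_zero, Finset.sum_empty, add_zero]
    calc _ = _ := by
          refine Finset.sum_congr rfl fun i _ => Finset.sum_congr rfl fun l _ => ?_
          congr 4; omega
      _ = _ := h2.symm
      _ = _ := by
          refine Finset.sum_congr rfl fun m _ => ?_
          rw [Finset.sum_congr rfl (g := fun _ => (w ⬝ᵥ (S ^ m *ᵥ u)) *
            (w ⬝ᵥ ((S + vecMulVec u w) ^ (P - 1 - m) *ᵥ u)))]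
          · simp
          · intro i hi
            have : i ≤ m := by simpa [Nat.lt_succ_iff] using hi
            congr 4 <;> omega

lemma dd_rec' (P : ℕ) : ((P : ℂ) + 1) * cc P + ∑ m ∈ Finset.range P,
    ((m : ℂ) + 1) * (cc m * qq (P - 1 - m)) = ((P : ℂ) + 1) ^ P / P.factorial := by
  rw [← dd_rec, ← Finset.sum_range_reflect (fun j => ((P - j : ℕ) : ℂ) * cc (P - 1 - j) * qq j)]
  congr 1
  refine Finset.sum_congr rfl fun m hm => ?_
  have : m < P := by simpa using hm
  have e1 : P - (P - 1 - m) = m + 1 := by omega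
  have e2 : P - 1 - (P - 1 - m) = m := by omega
  rw [e1, e2]; push_cast; ring

end rankone
end GTaux

namespace GTaux
section model

noncomputable def row (n l : ℕ) (ω : Fin n → Fin n → ℂ) : Fin n → ℂ :=
  if h : l < n then fun j => if n ≤ (j : ℕ) + l then ω ⟨n - 1 - l, by omega⟩ j else 0 else 0

noncomputable def Mk (n l : ℕ) : Matrix (Fin n) (Fin n) ℂ :=
  Matrix.diagonal fun j => if n ≤ (j : ℕ) + l then 1 else 0

noncomputable def Sm (n l : ℕ) (ω : Fin n → Fin n → ℂ) : Matrix (Fin n) (Fin n) ℂ :=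
  ∑ l' ∈ Finset.range l, Matrix.vecMulVec (star (row n l' ω)) (row n l' ω)

noncomputable def Am (n k l : ℕ) (ω : Fin n → Fin n → ℂ) : Matrix (Fin n) (Fin n) ℂ :=
  Mk n l * Sm n l ω ^ k

noncomputable def c (k n l : ℕ) (ω : Fin n → Fin n → ℂ) : ℂ := qf (Sm n l ω ^ k) (row n l ω)
noncomputable def q (k n l : ℕ) (ω : Fin n → Fin n → ℂ) : ℂ := qf (Sm n (l + 1) ω ^ k) (row n l ω)
noncomputable def tt (k n l : ℕ) (ω : Fin n → Fin n → ℂ) : ℂ := (n : ℂ)⁻¹ * (Am n k l ω).trace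
noncomputable def D (p n l : ℕ) (ω : Fin n → Fin n → ℂ) : ℂ :=
  ((p : ℂ) + 1) * c p n l ω + ∑ m ∈ Finset.range p, ((m : ℂ) + 1) * (c m n l ω * q (p - 1 - m) n l ω)

lemma Sm_succ (n l : ℕ) (ω : Fin n → Fin n → ℂ) :
    Sm n (l + 1) ω = Sm n l ω + Matrix.vecMulVec (star (row n l ω)) (row n l ω) := by
  simp [Sm, Finset.sum_range_succ]

lemma q_eq (k n l : ℕ) (ω : Fin n → Fin n → ℂ) :
    q k n l ω = c k n l ω + ∑ i ∈ Finset.range k, c i n l ω * q (k - 1 - i) n l ω := by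
  simp only [q, c, qf, Sm_succ]
  exact q_rec _ _ _ _

lemma trace_succ (p n l : ℕ) (ω : Fin n → Fin n → ℂ) :
    (Sm n (l + 1) ω ^ (p + 1)).trace = (Sm n l ω ^ (p + 1)).trace + D p n l ω := by
  simp only [D, q, c, qf, Sm_succ]
  exact D_rec _ _ _ _

lemma trace_eq (p n l : ℕ) (ω : Fin n → Fin n → ℂ) :
    (Sm n l ω ^ (p + 1)).trace = ∑ l' ∈ Finset.range l, D p n l' ω := by
  induction l with
  | zero => simp [Sm]
  | succ l ih => rw [trace_succ, ih, Finset.sum_range_succ]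

lemma row_zero {n l : ℕ} (ω : Fin n → Fin n → ℂ) (j : Fin n) (h : ¬ n ≤ (j : ℕ) + l) :
    row n l ω j = 0 := by
  unfold row; split_ifs <;> simp [h]

lemma Mk_vec {n l l' : ℕ} (h : l' ≤ l) (ω : Fin n → Fin n → ℂ) :
    Mk n l * Matrix.vecMulVec (star (row n l' ω)) (row n l' ω) =
      Matrix.vecMulVec (star (row n l' ω)) (row n l' ω) := by
  ext i j
  rw [Mk, Matrix.diagonal_mul, Matrix.vecMulVec_apply]
  by_cases hi : n ≤ (i : ℕ) + l
  · simp [hi]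
  · simp [row_zero ω i (show ¬ n ≤ (i : ℕ) + l' by omega)]

lemma vec_Mk {n l l' : ℕ} (h : l' ≤ l) (ω : Fin n → Fin n → ℂ) :
    Matrix.vecMulVec (star (row n l' ω)) (row n l' ω) * Mk n l =
      Matrix.vecMulVec (star (row n l' ω)) (row n l' ω) := by
  ext i j
  rw [Mk, Matrix.mul_diagonal, Matrix.vecMulVec_apply]
  by_cases hi : n ≤ (j : ℕ) + l
  · simp [hi]
  · simp [row_zero ω j (show ¬ n ≤ (j : ℕ) + l' by omega)]

lemma Mk_Sm (n l : ℕ) (ω : Fin n → Fin n → ℂ) : Mk n l * Sm n l ω = Sm n l ω := by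
  rw [Sm, Finset.mul_sum]
  exact Finset.sum_congr rfl fun i hi => Mk_vec (by simp at hi; omega) ω

lemma Sm_Mk (n l : ℕ) (ω : Fin n → Fin n → ℂ) : Sm n l ω * Mk n l = Sm n l ω := by
  rw [Sm, Finset.sum_mul]
  exact Finset.sum_congr rfl fun i hi => vec_Mk (by simp at hi; omega) ω

lemma Mk_Mk (n l : ℕ) : Mk n l * Mk n l = Mk n l := by
  simp [Mk, Matrix.diagonal_mul_diagonal]

lemma Mk_herm (n l : ℕ) : (Mk n l)ᴴ = Mk n l := by
  rw [Mk, Matrix.diagonal_conjTranspose]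
  congr 1; ext j; simp only [Pi.star_apply]; split_ifs <;> simp

lemma Mk_comm (n k l : ℕ) (ω : Fin n → Fin n → ℂ) : Commute (Mk n l) (Sm n l ω ^ k) := by
  apply Commute.pow_right
  rw [Commute, SemiconjBy, Mk_Sm, Sm_Mk]

lemma Am_succ (n k l : ℕ) (ω : Fin n → Fin n → ℂ) : Am n (k + 1) l ω = Sm n l ω ^ (k + 1) := by
  rw [Am, pow_succ', ← mul_assoc, Mk_Sm]

lemma Am_eq (n k l : ℕ) (ω : Fin n → Fin n → ℂ) :
    Am n k l ω = (Mk n l)ᴴ * Sm n l ω ^ k * Mk n l := by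
  rw [Mk_herm, mul_assoc, ← (Mk_comm n k l ω).eq, ← mul_assoc, Mk_Mk, Am]

lemma Am_mul (n k l : ℕ) (ω : Fin n → Fin n → ℂ) :
    Am n k l ω * Am n k l ω = Am n (2 * k) l ω := by
  unfold Am
  rw [mul_assoc, ← mul_assoc (_ ^ k), ← (Mk_comm n k l ω).eq, mul_assoc, ← mul_assoc, Mk_Mk,
    ← pow_add, two_mul]

section
open scoped ComplexOrder
lemma Sm_psd (n l : ℕ) (ω : Fin n → Fin n → ℂ) : (Sm n l ω).PosSemidef := by
  unfold Sm
  refine Matrix.posSemidef_sum _ fun i _ => ?_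
  have := Matrix.posSemidef_vecMulVec_self_star (star (row n i ω))
  simpa using this

lemma Am_psd (n k l : ℕ) (ω : Fin n → Fin n → ℂ) : (Am n k l ω).PosSemidef := by
  rw [Am_eq]
  exact ((Sm_psd n l ω).pow k).conjTranspose_mul_mul_same _
end

lemma row_eq {n l : ℕ} (h : l < n) (ω : Fin n → Fin n → ℂ) :
    row n l ω = Mk n l *ᵥ ω ⟨n - 1 - l, by omega⟩ := by
  ext j
  simp [row, h, Mk, Matrix.mulVec_diagonal]

lemma row_eq' {n l : ℕ} (h : l < n) (ω : Fin n → Fin n → ℂ) :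
    row n l ω = ω ⟨n - 1 - l, by omega⟩ ᵥ* Mk n l := by
  ext j
  simp [row, h, Mk, Matrix.vecMul_diagonal]

lemma c_eq {n l : ℕ} (k : ℕ) (h : l < n) (ω : Fin n → Fin n → ℂ) :
    c k n l ω = qf (Am n k l ω) (ω ⟨n - 1 - l, by omega⟩) := by
  unfold c qf
  have h1 : star (row n l ω) = Mk n l *ᵥ star (ω ⟨n - 1 - l, by omega⟩) := by
    rw [row_eq' h, Matrix.star_vecMul, Mk_herm]
  rw [h1, row_eq' h, ← Matrix.dotProduct_mulVec, Matrix.mulVec_mulVec, Matrix.mulVec_mulVec,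
    Am_eq, Mk_herm, mul_assoc]

lemma tt_zero {n l : ℕ} (h : l ≤ n) (ω : Fin n → Fin n → ℂ) : tt 0 n l ω = (l : ℂ) / n := by
  have : (Am n 0 l ω).trace = l := by
    rw [Am, pow_zero, mul_one, Mk, Matrix.trace_diagonal,
      Fin.sum_univ_eq_sum_range (fun j => if n ≤ j + l then (1 : ℂ) else 0)]
    obtain ⟨m, rfl⟩ := Nat.exists_eq_add_of_le' h
    rw [Finset.sum_range_add, Finset.sum_eq_zero, zero_add, Finset.sum_congr rfl (g := fun _ => 1)]
    · simp
    · intro x _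
      rw [if_pos (by omega)]
    · intro x hx
      rw [Finset.mem_range] at hx
      rw [if_neg (by omega)]
  rw [tt, this]; ring

lemma tt_succ (p n l : ℕ) (ω : Fin n → Fin n → ℂ) :
    tt (p + 1) n l ω = (n : ℂ)⁻¹ * ∑ l' ∈ Finset.range l, D p n l' ω := by
  rw [tt, Am_succ, trace_eq]

lemma row_update {n l l' : ℕ} (h : l' < l) (hl : l < n) (ω : Fin n → Fin n → ℂ) (x : Fin n → ℂ) :
    row n l' (Function.update ω ⟨n - 1 - l, by omega⟩ x) = row n l' ω := by
  unfold row
  split_ifs with h1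
  · rw [Function.update_of_ne]
    simp; omega
  · rfl

lemma Sm_update {n l : ℕ} (hl : l < n) (ω : Fin n → Fin n → ℂ) (x : Fin n → ℂ) :
    Sm n l (Function.update ω ⟨n - 1 - l, by omega⟩ x) = Sm n l ω := by
  unfold Sm
  refine Finset.sum_congr rfl fun i hi => ?_
  rw [row_update (by simpa using hi) hl]

lemma Am_update {n l : ℕ} (k : ℕ) (hl : l < n) (ω : Fin n → Fin n → ℂ) (x : Fin n → ℂ) :
    Am n k l (Function.update ω ⟨n - 1 - l, by omega⟩ x) = Am n k l ω := by
  rw [Am, Am, Sm_update hl]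

lemma Sm_full (n : ℕ) (ω : Fin n → Fin n → ℂ) (T : Fin n → Fin n → ℂ)
    (hT : ∀ i j, T i j = if (i : ℕ) < j then ω i j else 0) :
    (Matrix.of T)ᴴ * Matrix.of T = Sm n n ω := by
  ext a b
  rw [Matrix.mul_apply, Sm, Matrix.sum_apply, ← Fin.sum_univ_eq_sum_range
    (fun l' => Matrix.vecMulVec (star (row n l' ω)) (row n l' ω) a b), ← Equiv.sum_comp Fin.revPerm (fun i => (Matrix.of T)ᴴ a i * (Matrix.of T) i b)]
  refine Finset.sum_congr rfl fun i _ => ?_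
  have : ∀ j, T (Fin.revPerm i) j = row n i ω j := by
    intro j
    rw [hT]
    simp only [row, i.2, dite_true, Fin.revPerm_apply, Fin.val_rev]
    have h1 : (n - ((i : ℕ) + 1) < j) ↔ n ≤ (j : ℕ) + i := by omega
    have h2 : Fin.rev i = ⟨n - 1 - i, by omega⟩ := by ext; simp [Fin.val_rev]; omega
    simp only [h1, h2]
  rw [Matrix.conjTranspose_apply, Matrix.of_apply, Matrix.of_apply, this, this,
    Matrix.vecMulVec_apply, Pi.star_apply]

lemma cont_row (n l : ℕ) : Continuous (row n l) := by
  unfold row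
  split_ifs
  · refine continuous_pi fun j => ?_
    split_ifs <;> fun_prop
  · exact continuous_const

lemma cont_Sm (n l : ℕ) : Continuous (Sm n l) := by
  unfold Sm
  refine continuous_finsetSum _ fun i _ => ?_
  exact (cont_row n i).star.matrix_vecMulVec (cont_row n i)

lemma cont_c (k n l : ℕ) : Continuous (c k n l) := by
  unfold c qf
  exact (cont_row n l).dotProduct (((cont_Sm n l).pow k).matrix_mulVec (cont_row n l).star)

lemma cont_q (k n l : ℕ) : Continuous (q k n l) := by
  unfold q qf
  exact (cont_row n l).dotProduct (((cont_Sm n (l+1)).pow k).matrix_mulVec (cont_row n l).star)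

lemma cont_tt (k n l : ℕ) : Continuous (tt k n l) := by
  unfold tt Am
  exact continuous_const.mul (Continuous.matrix_trace (continuous_const.mul ((cont_Sm n l).pow k)))

lemma cont_qf {ι : Type*} [Fintype ι] (A : Matrix ι ι ℂ) : Continuous (qf A) := by
  unfold qf
  exact continuous_id.dotProduct (continuous_const.matrix_mulVec continuous_id.star)

end model
end GTaux

namespace GTaux
section measure

lemma lintegral_upd {ι : Type*} [Fintype ι] [DecidableEq ι] {E : Type*} [MeasurableSpace E]
    [Nonempty E] (μ : ι → Measure E) [∀ i, IsProbabilityMeasure (μ i)] (i : ι)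
    {F : (ι → E) → ℝ≥0∞} (hF : Measurable F) :
    ∫⁻ ω, F ω ∂(Measure.pi μ) =
      ∫⁻ ω, ∫⁻ x, F (Function.update ω i x) ∂(μ i) ∂(Measure.pi μ) := by
  have hG : Measurable fun ω : ι → E => ∫⁻ x, F (Function.update ω i x) ∂(μ i) := by
    have := hF.lmarginal μ (s := {i})
    simpa only [lmarginal_singleton] using this
  have x0 : ι → E := fun _ => Classical.arbitrary E
  rw [lintegral_eq_lmarginal_univ x0, lintegral_eq_lmarginal_univ x0,
    lmarginal_erase' F hF (Finset.mem_univ i),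
    lmarginal_erase' _ hG (Finset.mem_univ i)]
  simp

noncomputable def mu (n : ℕ) : Measure (Fin n → Fin n → ℂ) :=
  Measure.pi fun _ => Measure.pi fun _ => complexGaussian (n : ℝ≥0)⁻¹

instance (n : ℕ) : IsProbabilityMeasure (mu n) := by unfold mu; infer_instance

lemma GTlaw_eq (n : ℕ) : GTlaw n =
    (mu n).map fun (ω : Fin n → Fin n → ℂ) (i j : Fin n) => if (i : ℕ) < (j : ℕ) then ω i j else 0 := by
  let f : Fin n → Fin n → ℂ → ℂ := fun i j z => if (i : ℕ) < (j : ℕ) then z else 0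
  have hf : ∀ i j, Measurable (f i j) := by
    intro i j
    simp only [f]
    split_ifs
    · exact measurable_id
    · exact measurable_const
  have h1 : ∀ i j, (complexGaussian (n : ℝ≥0)⁻¹).map (f i j) =
      if (i : ℕ) < (j : ℕ) then complexGaussian ((n : ℝ≥0))⁻¹ else Measure.dirac 0 := by
    intro i j
    simp only [f]
    split_ifs
    · simp
    · simp [Measure.map_const]
  have h2 : ∀ i, (Measure.pi fun _ : Fin n => complexGaussian (n : ℝ≥0)⁻¹).map
      (fun z j => f i j (z j)) = Measure.pi fun j : Fin n =>
        if (i : ℕ) < (j : ℕ) then complexGaussian ((n : ℝ≥0))⁻¹ else Measure.dirac 0 := by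
    intro i
    rw [Measure.pi_map_pi (fun j => (hf i j).aemeasurable)]
    simp only [h1]
  unfold GTlaw mu
  simp only [← h2]
  symm
  refine Measure.pi_map_pi (f := fun i (z : Fin n → ℂ) j => f i j (z j)) ?_
  intro i
  exact (measurable_pi_lambda _ fun j => (hf i j).comp (measurable_pi_apply j)).aemeasurable

lemma c_moment {n l : ℕ} (h : l < n) (k r : ℕ) :
    ∫⁻ ω, ‖c k n l ω‖ₑ ^ r ∂(mu n) ≤ r.factorial * ∫⁻ ω, ‖tt k n l ω‖ₑ ^ r ∂(mu n) := by
  have hv : (n : ℝ≥0)⁻¹ ≠ 0 := by simp; omega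
  rw [mu, lintegral_upd _ ⟨n - 1 - l, by omega⟩
    (((cont_c k n l).measurable.enorm).pow_const r), ← lintegral_const_mul _
      ((cont_tt k n l).measurable.enorm.pow_const r)]
  refine lintegral_mono fun ω => ?_
  simp only [c_eq k h, Am_update k h, Function.update_self]
  refine (qf_moment hv (Am_psd n k l ω) r).trans (le_of_eq ?_)
  simp [tt]

lemma c_var {n l : ℕ} (h : l < n) (k : ℕ) :
    ∫⁻ ω, ‖c k n l ω - tt k n l ω‖ₑ ^ 2 ∂(mu n) =
      (n : ℝ≥0∞)⁻¹ * ∫⁻ ω, ‖tt (2 * k) n l ω‖ₑ ∂(mu n) := by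
  have hv : (n : ℝ≥0)⁻¹ ≠ 0 := by simp; omega
  rw [mu, lintegral_upd _ ⟨n - 1 - l, by omega⟩
    (F := fun ω => ‖c k n l ω - tt k n l ω‖ₑ ^ 2)
    ((((cont_c k n l).sub (cont_tt k n l)).measurable.enorm).pow_const 2),
      ← lintegral_const_mul _ ((cont_tt (2 * k) n l).measurable.enorm)]
  refine lintegral_congr fun ω => ?_
  simp only [c_eq k h, Am_update k h, Function.update_self, tt]
  have := qf_var_enorm hv (Am_psd n k l ω)
  rw [Am_mul] at this
  simp only [NNReal.coe_inv, NNReal.coe_natCast, Complex.ofReal_inv, Complex.ofReal_natCast] at this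
  rw [this, pow_two, mul_assoc, enorm_mul]
  congr 1
  rw [enorm_inv (by simp; omega), ← ofReal_norm, Complex.norm_natCast,
    ENNReal.ofReal_natCast]

end measure
end GTaux

namespace GTaux
section framework

abbrev Fam := (n : ℕ) → ℕ → (Fin n → Fin n → ℂ) → ℂ

def Bdd (X : Fam) : Prop := (∀ n l, Measurable (X n l)) ∧
  ∀ r : ℕ, ∃ C : ℝ≥0, ∀ n l, l < n → ∫⁻ ω, ‖X n l ω‖ₑ ^ r ∂(mu n) ≤ C

def Null (X : Fam) : Prop := (∀ n l, Measurable (X n l)) ∧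
  ∀ ε : ℝ≥0, ε ≠ 0 → ∃ N, ∀ n, N ≤ n → ∀ l, l < n → ∫⁻ ω, ‖X n l ω‖ₑ ∂(mu n) ≤ ε

lemma add_pow_le' (a b : ℝ≥0∞) (r : ℕ) : (a + b) ^ r ≤ 2 ^ r * (a ^ r + b ^ r) := by
  have h : a + b ≤ 2 * max a b := by
    rw [two_mul]; exact add_le_add (le_max_left _ _) (le_max_right _ _)
  calc (a + b) ^ r ≤ (2 * max a b) ^ r := by gcongr
    _ = 2 ^ r * (max a b) ^ r := mul_pow _ _ _
    _ ≤ _ := by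
      gcongr
      rcases max_choice a b with h | h <;> rw [h]
      · exact le_self_add
      · exact le_add_self

lemma mul_pow_le' (a b : ℝ≥0∞) (r : ℕ) : (a * b) ^ r ≤ a ^ (2 * r) + b ^ (2 * r) := by
  have h : a * b ≤ (max a b) ^ 2 := by
    rw [pow_two]; exact mul_le_mul' (le_max_left _ _) (le_max_right _ _)
  calc (a * b) ^ r ≤ ((max a b) ^ 2) ^ r := by gcongr
    _ = (max a b) ^ (2 * r) := (pow_mul _ _ _).symm
    _ ≤ _ := by
      rcases max_choice a b with h | h <;> rw [h]
      · exact le_self_add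
      · exact le_add_self

lemma Bdd.add {X Y : Fam} (hX : Bdd X) (hY : Bdd Y) : Bdd (fun n l ω => X n l ω + Y n l ω) := by
  refine ⟨fun n l => (hX.1 n l).add (hY.1 n l), fun r => ?_⟩
  obtain ⟨C, hC⟩ := hX.2 r
  obtain ⟨C', hC'⟩ := hY.2 r
  refine ⟨2 ^ r * (C + C'), fun n l h => ?_⟩
  calc ∫⁻ ω, ‖X n l ω + Y n l ω‖ₑ ^ r ∂(mu n)
      ≤ ∫⁻ ω, 2 ^ r * (‖X n l ω‖ₑ ^ r + ‖Y n l ω‖ₑ ^ r) ∂(mu n) := by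
        refine lintegral_mono fun ω => le_trans ?_ (add_pow_le' _ _ r)
        gcongr
        exact enorm_add_le _ _
    _ = 2 ^ r * (∫⁻ ω, ‖X n l ω‖ₑ ^ r ∂(mu n) + ∫⁻ ω, ‖Y n l ω‖ₑ ^ r ∂(mu n)) := by
        rw [lintegral_const_mul' _ _ (by simp), lintegral_add_left ((hX.1 n l).enorm.pow_const r)]
    _ ≤ _ := by
        push_cast
        gcongr
        · exact hC n l h
        · exact hC' n l h

lemma Bdd.mul {X Y : Fam} (hX : Bdd X) (hY : Bdd Y) : Bdd (fun n l ω => X n l ω * Y n l ω) := by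
  refine ⟨fun n l => (hX.1 n l).mul (hY.1 n l), fun r => ?_⟩
  obtain ⟨C, hC⟩ := hX.2 (2 * r)
  obtain ⟨C', hC'⟩ := hY.2 (2 * r)
  refine ⟨C + C', fun n l h => ?_⟩
  calc ∫⁻ ω, ‖X n l ω * Y n l ω‖ₑ ^ r ∂(mu n)
      ≤ ∫⁻ ω, (‖X n l ω‖ₑ ^ (2 * r) + ‖Y n l ω‖ₑ ^ (2 * r)) ∂(mu n) := by
        refine lintegral_mono fun ω => ?_
        rw [enorm_mul]
        exact mul_pow_le' _ _ r
    _ = ∫⁻ ω, ‖X n l ω‖ₑ ^ (2 * r) ∂(mu n) + ∫⁻ ω, ‖Y n l ω‖ₑ ^ (2 * r) ∂(mu n) := by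
        rw [lintegral_add_left ((hX.1 n l).enorm.pow_const _)]
    _ ≤ _ := by
        push_cast
        gcongr
        · exact hC n l h
        · exact hC' n l h

lemma Bdd.of_le {X : Fam} (hm : ∀ n l, Measurable (X n l)) (C : ℝ≥0)
    (h : ∀ n l, l < n → ∀ ω, ‖X n l ω‖ₑ ≤ C) : Bdd X := by
  refine ⟨hm, fun r => ⟨C ^ r, fun n l hl => ?_⟩⟩
  calc ∫⁻ ω, ‖X n l ω‖ₑ ^ r ∂(mu n) ≤ ∫⁻ ω, (C : ℝ≥0∞) ^ r ∂(mu n) := by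
        refine lintegral_mono fun ω => ?_
        gcongr
        exact h n l hl ω
    _ = _ := by simp

lemma Bdd.const (a : ℂ) : Bdd (fun _ _ _ => a) :=
  Bdd.of_le (fun _ _ => measurable_const) ‖a‖₊ (fun _ _ _ _ => le_rfl)

lemma Bdd.sum {ι : Type*} (s : Finset ι) {X : ι → Fam} (h : ∀ i ∈ s, Bdd (X i)) :
    Bdd (fun n l ω => ∑ i ∈ s, X i n l ω) := by
  classical
  induction s using Finset.induction_on with
  | empty => simpa using Bdd.const 0
  | insert a s ha ih =>
    simp only [Finset.sum_insert ha]
    exact (h a (by simp)).add (ih fun i hi => h i (by simp [hi]))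

lemma Bdd.pow {X : Fam} (hX : Bdd X) (j : ℕ) : Bdd (fun n l ω => X n l ω ^ j) := by
  induction j with
  | zero => simpa using Bdd.const 1
  | succ j ih => simpa only [pow_succ] using ih.mul hX

lemma Bdd.avg {X : Fam} (hX : Bdd X) :
    Bdd (fun n l ω => (n : ℂ)⁻¹ * ∑ l' ∈ Finset.range l, X n l' ω) := by
  refine ⟨fun n l => measurable_const.mul (Finset.measurable_sum _ fun i _ => hX.1 n i),
    fun r => ?_⟩
  rcases Nat.eq_zero_or_pos r with rfl | hr
  · exact ⟨1, fun n l _ => by simp⟩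
  obtain ⟨C, hC⟩ := hX.2 r
  refine ⟨C, fun n l hl => ?_⟩
  have hn : (n : ℝ≥0∞) ≠ 0 := by simp; omega
  have hn2 : ‖(n : ℂ)⁻¹‖ₑ = (n : ℝ≥0∞)⁻¹ := by
    rw [enorm_inv (by simp; omega), ← ofReal_norm, Complex.norm_natCast, ENNReal.ofReal_natCast]
  calc ∫⁻ ω, ‖(n : ℂ)⁻¹ * ∑ l' ∈ Finset.range l, X n l' ω‖ₑ ^ r ∂(mu n)
      ≤ ∫⁻ ω, ∑ l' ∈ Finset.range n, (n : ℝ≥0∞)⁻¹ * ‖X n l' ω‖ₑ ^ r ∂(mu n) := by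
        refine lintegral_mono fun ω => ?_
        have h1 := ENNReal.rpow_arith_mean_le_arith_mean_rpow (Finset.range n)
          (fun _ => (n : ℝ≥0∞)⁻¹) (fun l' => ‖X n l' ω‖ₑ)
          (by simp [ENNReal.mul_inv_cancel hn]) (p := r) (by exact_mod_cast hr)
        simp only [ENNReal.rpow_natCast] at h1
        refine le_trans ?_ h1
        gcongr
        rw [enorm_mul, hn2, ← Finset.mul_sum]
        gcongr
        refine (enorm_sum_le _ _).trans ?_
        exact Finset.sum_le_sum_of_subset (Finset.range_mono hl.le)
    _ = ∑ l' ∈ Finset.range n, (n : ℝ≥0∞)⁻¹ * ∫⁻ ω, ‖X n l' ω‖ₑ ^ r ∂(mu n) := by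
        rw [lintegral_finsetSum _ fun i _ => ((hX.1 n i).enorm.pow_const r).const_mul _]
        exact Finset.sum_congr rfl fun i _ => lintegral_const_mul _ ((hX.1 n i).enorm.pow_const r)
    _ ≤ ∑ l' ∈ Finset.range n, (n : ℝ≥0∞)⁻¹ * C := by
        gcongr with i hi
        exact hC n i (by simpa using hi)
    _ = C := by
        rw [Finset.sum_const, Finset.card_range, nsmul_eq_mul, ← mul_assoc,
          ENNReal.mul_inv_cancel hn (by simp), one_mul]

lemma Null.add {X Y : Fam} (hX : Null X) (hY : Null Y) :
    Null (fun n l ω => X n l ω + Y n l ω) := by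
  refine ⟨fun n l => (hX.1 n l).add (hY.1 n l), fun ε hε => ?_⟩
  obtain ⟨N, hN⟩ := hX.2 (ε / 2) (by simpa using hε)
  obtain ⟨N', hN'⟩ := hY.2 (ε / 2) (by simpa using hε)
  refine ⟨max N N', fun n hn l hl => ?_⟩
  calc ∫⁻ ω, ‖X n l ω + Y n l ω‖ₑ ∂(mu n)
      ≤ ∫⁻ ω, (‖X n l ω‖ₑ + ‖Y n l ω‖ₑ) ∂(mu n) := lintegral_mono fun ω => enorm_add_le _ _
    _ = ∫⁻ ω, ‖X n l ω‖ₑ ∂(mu n) + ∫⁻ ω, ‖Y n l ω‖ₑ ∂(mu n) := by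
        rw [lintegral_add_left (hX.1 n l).enorm]
    _ ≤ ((ε / 2 : ℝ≥0) : ℝ≥0∞) + ((ε / 2 : ℝ≥0) : ℝ≥0∞) :=
        add_le_add (hN n (le_of_max_le_left hn) l hl) (hN' n (le_of_max_le_right hn) l hl)
    _ = ε := by rw [← ENNReal.coe_add, add_halves]

lemma young_aux (b : ℝ≥0∞) {δ : ℝ≥0} (hδ : δ ≠ 0) : b ≤ (δ⁻¹ : ℝ≥0) + δ * (b * b) := by
  rcases le_total b (δ⁻¹ : ℝ≥0) with h | h
  · exact h.trans le_self_add
  · refine le_trans ?_ le_add_self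
    calc b = ((δ * δ⁻¹ : ℝ≥0) : ℝ≥0∞) * b := by rw [mul_inv_cancel₀ hδ]; simp
      _ = δ * ((δ⁻¹ : ℝ≥0) * b) := by push_cast; rw [mul_assoc]
      _ ≤ _ := by gcongr

lemma Null.mul {X Y : Fam} (hX : Null X) (hX' : Bdd X) (hY : Bdd Y) :
    Null (fun n l ω => X n l ω * Y n l ω) := by
  refine ⟨fun n l => (hX.1 n l).mul (hY.1 n l), fun ε hε => ?_⟩
  obtain ⟨C, hC⟩ := (hX'.mul (hY.mul hY)).2 1
  set δ : ℝ≥0 := ε / (2 * (C + 1)) with hδ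
  have hδ0 : δ ≠ 0 := by rw [hδ]; positivity
  obtain ⟨N, hN⟩ := hX.2 (δ * (ε / 2)) (by positivity)
  refine ⟨N, fun n hn l hl => ?_⟩
  calc ∫⁻ ω, ‖X n l ω * Y n l ω‖ₑ ∂(mu n)
      ≤ ∫⁻ ω, (((δ⁻¹ : ℝ≥0) : ℝ≥0∞) * ‖X n l ω‖ₑ +
          δ * ‖X n l ω * (Y n l ω * Y n l ω)‖ₑ ^ 1) ∂(mu n) := by
        refine lintegral_mono fun ω => ?_
        simp only [enorm_mul, pow_one]
        calc ‖X n l ω‖ₑ * ‖Y n l ω‖ₑ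
            ≤ ‖X n l ω‖ₑ * ((δ⁻¹ : ℝ≥0) + δ * (‖Y n l ω‖ₑ * ‖Y n l ω‖ₑ)) :=
              mul_le_mul_right (young_aux _ hδ0) _
          _ = _ := by ring
    _ = ((δ⁻¹ : ℝ≥0) : ℝ≥0∞) * ∫⁻ ω, ‖X n l ω‖ₑ ∂(mu n) +
          δ * ∫⁻ ω, ‖X n l ω * (Y n l ω * Y n l ω)‖ₑ ^ 1 ∂(mu n) := by
        rw [lintegral_add_left ((hX.1 n l).enorm.const_mul _), lintegral_const_mul' _ _ (by simp),
          lintegral_const_mul' _ _ (by simp)]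
    _ ≤ ((δ⁻¹ : ℝ≥0) : ℝ≥0∞) * ((δ * (ε / 2) : ℝ≥0) : ℝ≥0∞) + δ * C := by
        gcongr
        · exact hN n hn l hl
        · exact hC n l hl
    _ = ((δ⁻¹ * (δ * (ε / 2)) + δ * C : ℝ≥0) : ℝ≥0∞) := by push_cast; rfl
    _ ≤ ε := by
        rw [ENNReal.coe_le_coe, ← mul_assoc, inv_mul_cancel₀ hδ0, one_mul]
        have : δ * C ≤ ε / 2 := by
          calc δ * C ≤ δ * (C + 1) := by gcongr; simp
            _ = ε / 2 := by rw [hδ]; field_simp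
        calc ε / 2 + δ * C ≤ ε / 2 + ε / 2 := by gcongr
          _ = ε := add_halves ε

lemma Null.zero : Null (fun _ _ _ => 0) :=
  ⟨fun _ _ => measurable_const, fun ε _ => ⟨0, fun n _ l _ => by simp⟩⟩

lemma Null.of_sq {X : Fam} (hm : ∀ n l, Measurable (X n l)) (C : ℝ≥0)
    (h : ∀ n l, l < n → ∫⁻ ω, ‖X n l ω‖ₑ ^ 2 ∂(mu n) ≤ (n : ℝ≥0∞)⁻¹ * C) : Null X := by
  refine ⟨hm, fun ε hε => ?_⟩
  obtain ⟨N, hN⟩ := exists_nat_gt ((ε / 2)⁻¹ * C * (ε / 2)⁻¹)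
  refine ⟨N, fun n hn l hl => ?_⟩
  have hn0 : (n : ℝ≥0) ≠ 0 := by simp; omega
  have he : (ε / 2) ≠ 0 := by positivity
  calc ∫⁻ ω, ‖X n l ω‖ₑ ∂(mu n)
      ≤ ∫⁻ ω, (((ε / 2 : ℝ≥0) : ℝ≥0∞) + ((ε / 2)⁻¹ : ℝ≥0) * ‖X n l ω‖ₑ ^ 2) ∂(mu n) := by
        refine lintegral_mono fun ω => ?_
        have := young_aux ‖X n l ω‖ₑ (inv_ne_zero he)
        rwa [inv_inv, ← pow_two] at this
    _ = ((ε / 2 : ℝ≥0) : ℝ≥0∞) + ((ε / 2)⁻¹ : ℝ≥0) * ∫⁻ ω, ‖X n l ω‖ₑ ^ 2 ∂(mu n) := by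
        rw [lintegral_add_left measurable_const, lintegral_const_mul' _ _ (by simp)]
        simp
    _ ≤ ((ε / 2 : ℝ≥0) : ℝ≥0∞) + ((ε / 2)⁻¹ : ℝ≥0) * ((n : ℝ≥0∞)⁻¹ * C) := by
        gcongr
        exact h n l hl
    _ = ((ε / 2 + (ε / 2)⁻¹ * ((n : ℝ≥0)⁻¹ * C) : ℝ≥0) : ℝ≥0∞) := by
        push_cast [ENNReal.coe_inv hn0]; rfl
    _ ≤ ε := by
        rw [ENNReal.coe_le_coe]
        have : (ε / 2)⁻¹ * ((n : ℝ≥0)⁻¹ * C) ≤ ε / 2 := by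
          have h1 : (ε / 2)⁻¹ * C * (ε / 2)⁻¹ ≤ n := hN.le.trans (by exact_mod_cast hn)
          have h2 : (ε / 2)⁻¹ * C ≤ n * (ε / 2) := by
            rwa [← div_eq_mul_inv, div_le_iff₀ (by positivity)] at h1
          calc (ε / 2)⁻¹ * ((n : ℝ≥0)⁻¹ * C) = (n : ℝ≥0)⁻¹ * ((ε / 2)⁻¹ * C) := by ring
            _ ≤ (n : ℝ≥0)⁻¹ * (n * (ε / 2)) := by gcongr
            _ = ε / 2 := by rw [← mul_assoc, inv_mul_cancel₀ hn0, one_mul]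
        calc _ ≤ ε / 2 + ε / 2 := by gcongr
          _ = ε := add_halves ε

end framework
end GTaux

namespace GTaux
section main

lemma Bdd.congr {X Y : Fam} (hX : Bdd X) (h : ∀ n l ω, l ≤ n → Y n l ω = X n l ω)
    (hm : ∀ n l, Measurable (Y n l)) : Bdd Y := by
  refine ⟨hm, fun r => ?_⟩
  obtain ⟨C, hC⟩ := hX.2 r
  refine ⟨C, fun n l hl => ?_⟩
  simp only [h n l _ hl.le]
  exact hC n l hl

lemma Bdd_c {k : ℕ} (h : Bdd (tt k)) : Bdd (c k) := by
  refine ⟨fun n l => (cont_c k n l).measurable, fun r => ?_⟩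
  obtain ⟨C, hC⟩ := h.2 r
  refine ⟨r.factorial * C, fun n l hl => (c_moment hl k r).trans ?_⟩
  push_cast
  gcongr
  exact hC n l hl

lemma Bdd_q (k : ℕ) (h : ∀ m ≤ k, Bdd (c m)) : Bdd (q k) := by
  induction k using Nat.strong_induction_on with
  | _ k ih =>
    have : q k = fun n l ω => c k n l ω + ∑ i ∈ Finset.range k, c i n l ω * q (k - 1 - i) n l ω := by
      funext n l ω
      exact q_eq k n l ω
    rw [this]
    refine (h k le_rfl).add (Bdd.sum _ fun i hi => ?_)
    rw [Finset.mem_range] at hi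
    exact (h i hi.le).mul (ih _ (by omega) fun m hm => h m (by omega))

lemma Bdd_D (p : ℕ) (h : ∀ m ≤ p, Bdd (c m)) : Bdd (D p) := by
  refine ((Bdd.const _).mul (h p le_rfl)).add (Bdd.sum _ fun i hi => ?_)
  rw [Finset.mem_range] at hi
  exact (Bdd.const _).mul ((h i hi.le).mul (Bdd_q _ fun m hm => h m (by omega)))

lemma Bdd_frac : Bdd (fun n l _ => (l : ℂ) / n) := by
  refine Bdd.of_le (fun _ _ => measurable_const) 1 fun n l hl ω => ?_
  rw [← ofReal_norm]
  simp only [norm_div, Complex.norm_natCast]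
  simp only [ENNReal.coe_one, ENNReal.ofReal_le_one]
  exact div_le_one_of_le₀ (by exact_mod_cast hl.le) (by positivity)

lemma Bdd_tt (k : ℕ) : Bdd (tt k) := by
  induction k using Nat.strong_induction_on with
  | _ k ih =>
    cases k with
    | zero => exact Bdd_frac.congr (fun n l ω hl => tt_zero hl ω) fun n l => (cont_tt 0 n l).measurable
    | succ p =>
      have : tt (p + 1) = fun (n l : ℕ) ω => (n : ℂ)⁻¹ * ∑ l' ∈ Finset.range l, D p n l' ω := by
        funext n l ω
        exact tt_succ p n l ω
      rw [this]
      exact (Bdd_D p fun m hm => Bdd_c (ih m (by omega))).avg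

lemma Null_c_sub (k : ℕ) : Null (fun n l ω => c k n l ω - tt k n l ω) := by
  obtain ⟨C, hC⟩ := (Bdd_tt (2 * k)).2 1
  refine Null.of_sq (fun n l => (cont_c k n l).measurable.sub (cont_tt k n l).measurable) C
    fun n l hl => ?_
  rw [c_var hl]
  gcongr
  simpa using hC n l hl

def Good (X : Fam) (x : ℕ → ℕ → ℂ) : Prop :=
  Bdd X ∧ Bdd (fun n l _ => x n l) ∧ Null (fun n l ω => X n l ω - x n l)

lemma Good.add {X Y : Fam} {x y} (hX : Good X x) (hY : Good Y y) :
    Good (fun n l ω => X n l ω + Y n l ω) (fun n l => x n l + y n l) := by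
  refine ⟨hX.1.add hY.1, hX.2.1.add hY.2.1, ?_⟩
  convert hX.2.2.add hY.2.2 using 4
  ring

lemma Bdd.sub {X Y : Fam} (hX : Bdd X) (hY : Bdd Y) : Bdd (fun n l ω => X n l ω - Y n l ω) := by
  convert hX.add ((Bdd.const (-1)).mul hY) using 4
  ring

lemma Good.mul {X Y : Fam} {x y} (hX : Good X x) (hY : Good Y y) :
    Good (fun n l ω => X n l ω * Y n l ω) (fun n l => x n l * y n l) := by
  refine ⟨hX.1.mul hY.1, hX.2.1.mul hY.2.1, ?_⟩
  convert (hX.2.2.mul (hX.1.sub hX.2.1) hY.1).add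
    (hY.2.2.mul (hY.1.sub hY.2.1) hX.2.1) using 4
  ring

lemma Good.const (a : ℂ) : Good (fun _ _ _ => a) (fun _ _ => a) := by
  refine ⟨Bdd.const a, Bdd.const a, ?_⟩
  simpa using Null.zero

lemma Good.sum {ι : Type*} (s : Finset ι) {X : ι → Fam} {x : ι → ℕ → ℕ → ℂ}
    (h : ∀ i ∈ s, Good (X i) (x i)) :
    Good (fun n l ω => ∑ i ∈ s, X i n l ω) (fun n l => ∑ i ∈ s, x i n l) := by
  classical
  induction s using Finset.induction_on with
  | empty => simpa using Good.const 0
  | insert a s ha ih =>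
    simp only [Finset.sum_insert ha]
    exact (h a (by simp)).add (ih fun i hi => h i (by simp [hi]))

noncomputable def pw (a : ℂ) (j : ℕ) (n l : ℕ) : ℂ := a * ((l : ℂ) / n) ^ j

lemma Bdd_pw (a : ℂ) (j : ℕ) : Bdd (fun n l _ => pw a j n l) :=
  (Bdd.const a).mul (Bdd_frac.pow j)

lemma Good_c {k : ℕ} (h : Good (tt k) (pw (cc k) (k + 1))) : Good (c k) (pw (cc k) (k + 1)) := by
  refine ⟨Bdd_c h.1, h.2.1, ?_⟩
  convert (Null_c_sub k).add h.2.2 using 4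
  ring

lemma Good_q (k : ℕ) (h : ∀ m ≤ k, Good (c m) (pw (cc m) (m + 1))) :
    Good (q k) (pw (qq k) (k + 1)) := by
  induction k using Nat.strong_induction_on with
  | _ k ih =>
    have h1 : q k = fun n l ω => c k n l ω + ∑ i ∈ Finset.range k, c i n l ω * q (k - 1 - i) n l ω := by
      funext n l ω
      exact q_eq k n l ω
    have h2 : pw (qq k) (k + 1) = fun n l => pw (cc k) (k + 1) n l + ∑ i ∈ Finset.range k,
        pw (cc i) (i + 1) n l * pw (qq (k - 1 - i)) (k - 1 - i + 1) n l := by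
      funext n l
      unfold pw
      rw [qq_rec, add_mul, Finset.sum_mul]
      congr 1
      refine Finset.sum_congr rfl fun i hi => ?_
      rw [Finset.mem_range] at hi
      rw [show k + 1 = (i + 1) + (k - 1 - i + 1) by omega, pow_add]
      ring
    rw [h1, h2]
    refine (h k le_rfl).add (Good.sum _ fun i hi => ?_)
    rw [Finset.mem_range] at hi
    exact (h i hi.le).mul (ih _ (by omega) fun m hm => h m (by omega))

lemma Good_D (p : ℕ) (h : ∀ m ≤ p, Good (c m) (pw (cc m) (m + 1))) :
    Good (D p) (pw (((p : ℂ) + 1) ^ p / (p.factorial : ℂ)) (p + 1)) := by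
  have h2 : pw (((p : ℂ) + 1) ^ p / (p.factorial : ℂ)) (p + 1) = fun n l =>
      ((p : ℂ) + 1) * pw (cc p) (p + 1) n l + ∑ m ∈ Finset.range p, ((m : ℂ) + 1) *
        (pw (cc m) (m + 1) n l * pw (qq (p - 1 - m)) (p - 1 - m + 1) n l) := by
    funext n l
    unfold pw
    rw [← dd_rec', add_mul, Finset.sum_mul, mul_assoc]
    congr 1
    refine Finset.sum_congr rfl fun i hi => ?_
    rw [Finset.mem_range] at hi
    rw [show p + 1 = (i + 1) + (p - 1 - i + 1) by omega, pow_add]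
    ring
  rw [h2]
  refine ((Good.const _).mul (h p le_rfl)).add (Good.sum _ fun i hi => ?_)
  rw [Finset.mem_range] at hi
  exact (Good.const _).mul ((h i hi.le).mul (Good_q _ fun m hm => h m (by omega)))

lemma pow_succ_sub_le (j l : ℕ) :
    |((l : ℝ) + 1) ^ (j + 1) - (l : ℝ) ^ (j + 1) - (j + 1) * (l : ℝ) ^ j| ≤
      (j + 1) * (((l : ℝ) + 1) ^ j - (l : ℝ) ^ j) := by
  have h1 : ((l : ℝ) + 1) ^ (j + 1) - (l : ℝ) ^ (j + 1) =
      ∑ i ∈ Finset.range (j + 1), ((l : ℝ) + 1) ^ i * (l : ℝ) ^ (j - i) := by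
    have := Commute.geom_sum₂_mul (Commute.all ((l : ℝ) + 1) (l : ℝ)) (j + 1)
    simp only [add_sub_cancel_left, mul_one, add_tsub_cancel_right] at this
    exact this.symm
  have hlo : ((j : ℝ) + 1) * (l : ℝ) ^ j ≤ ((l : ℝ) + 1) ^ (j + 1) - (l : ℝ) ^ (j + 1) := by
    rw [h1]
    calc ((j : ℝ) + 1) * (l : ℝ) ^ j = ∑ i ∈ Finset.range (j + 1), (l : ℝ) ^ j := by simp
      _ ≤ _ := by
        refine Finset.sum_le_sum fun i hi => ?_
        rw [Finset.mem_range] at hi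
        calc (l : ℝ) ^ j = (l : ℝ) ^ i * (l : ℝ) ^ (j - i) := by
              rw [← pow_add]; congr 1; omega
          _ ≤ _ := by gcongr; linarith
  have hhi : ((l : ℝ) + 1) ^ (j + 1) - (l : ℝ) ^ (j + 1) ≤ ((j : ℝ) + 1) * ((l : ℝ) + 1) ^ j := by
    rw [h1]
    calc _ ≤ ∑ i ∈ Finset.range (j + 1), ((l : ℝ) + 1) ^ j := by
          refine Finset.sum_le_sum fun i hi => ?_
          rw [Finset.mem_range] at hi
          calc ((l : ℝ) + 1) ^ i * (l : ℝ) ^ (j - i) ≤ ((l : ℝ) + 1) ^ i * ((l : ℝ) + 1) ^ (j - i) := by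
                gcongr; linarith
            _ = ((l : ℝ) + 1) ^ j := by rw [← pow_add]; congr 1; omega
      _ = _ := by simp
  rw [abs_le]
  constructor <;> nlinarith

lemma sum_pow_close (j l : ℕ) :
    |(∑ i ∈ Finset.range l, (i : ℝ) ^ j) * (j + 1) - (l : ℝ) ^ (j + 1)| ≤ (j + 1) * (l : ℝ) ^ j := by
  have : |(∑ i ∈ Finset.range l, (i : ℝ) ^ j) * (j + 1) - (l : ℝ) ^ (j + 1)| ≤
      (j + 1) * ((l : ℝ) ^ j - (0 : ℝ) ^ j) := by
    induction l with
    | zero => simp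
    | succ l ih =>
      have h := pow_succ_sub_le j l
      rw [Finset.sum_range_succ]
      push_cast
      rw [abs_le] at *
      constructor <;> nlinarith
  refine this.trans ?_
  gcongr
  have : (0 : ℝ) ≤ 0 ^ j := by positivity
  linarith

lemma avg_det (a : ℂ) (j n l : ℕ) (hl : l ≤ n) :
    ‖(n : ℂ)⁻¹ * ∑ l' ∈ Finset.range l, pw a j n l' - pw (a / (j + 1)) (j + 1) n l‖ ≤
      ‖a‖ * (n : ℝ)⁻¹ := by
  rcases Nat.eq_zero_or_pos n with rfl | hn
  · obtain rfl : l = 0 := by omega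
    simp [pw]
  have hn' : (n : ℝ) ≠ 0 := by positivity
  have hj : ((j : ℂ) + 1) ≠ 0 := by exact_mod_cast Nat.succ_ne_zero j
  have hnc : (n : ℂ) ≠ 0 := by exact_mod_cast hn.ne'
  have key : (n : ℂ)⁻¹ * ∑ l' ∈ Finset.range l, pw a j n l' - pw (a / (j + 1)) (j + 1) n l =
      a * (((((∑ i ∈ Finset.range l, (i : ℝ) ^ j) * (j + 1) - (l : ℝ) ^ (j + 1)) /
        ((j + 1) * (n : ℝ) ^ (j + 1)) : ℝ)) : ℂ) := by
    unfold pw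
    push_cast
    simp only [div_pow, ← Finset.mul_sum, ← Finset.sum_div]
    field_simp
    ring
  rw [key, norm_mul, Complex.norm_real, Real.norm_eq_abs, abs_div,
    abs_of_pos (show (0 : ℝ) < (j + 1) * (n : ℝ) ^ (j + 1) by positivity)]
  gcongr
  rw [div_le_iff₀ (by positivity)]
  refine (sum_pow_close j l).trans ?_
  calc ((j : ℝ) + 1) * (l : ℝ) ^ j ≤ (j + 1) * (n : ℝ) ^ j := by gcongr
    _ = _ := by field_simp; ring

lemma avg_null {X : Fam} {a : ℂ} {j : ℕ} (hX : Good X (pw a j)) (ε : ℝ≥0) (hε : ε ≠ 0) :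
    ∃ N, ∀ n, N ≤ n → ∀ l, l ≤ n → ∫⁻ ω, ‖(n : ℂ)⁻¹ * ∑ l' ∈ Finset.range l, X n l' ω -
      pw (a / (j + 1)) (j + 1) n l‖ₑ ∂(mu n) ≤ ε := by
  obtain ⟨N, hN⟩ := hX.2.2.2 (ε / 2) (by positivity)
  obtain ⟨N', hN'⟩ := exists_nat_gt (‖a‖₊ * (ε / 2)⁻¹)
  refine ⟨max (max N N') 1, fun n hn l hl => ?_⟩
  have hn1 : N ≤ n := by omega
  have hn2 : N' ≤ n := by omega
  have hn3 : 1 ≤ n := by omega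
  have hn0 : (n : ℝ≥0∞) ≠ 0 := by simp; omega
  have hne : ‖(n : ℂ)⁻¹‖ₑ = (n : ℝ≥0∞)⁻¹ := by
    rw [enorm_inv (by simp; omega), ← ofReal_norm, Complex.norm_natCast, ENNReal.ofReal_natCast]
  have hdet : ‖(n : ℂ)⁻¹ * ∑ l' ∈ Finset.range l, pw a j n l' -
      pw (a / (j + 1)) (j + 1) n l‖ₑ ≤ ((ε / 2 : ℝ≥0) : ℝ≥0∞) := by
    rw [enorm_eq_nnnorm, ENNReal.coe_le_coe, ← NNReal.coe_le_coe, coe_nnnorm]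
    refine (avg_det a j n l hl).trans ?_
    rw [← coe_nnnorm a, ← NNReal.coe_natCast, ← NNReal.coe_inv, ← NNReal.coe_mul, NNReal.coe_le_coe]
    have hnn : (0 : ℝ≥0) < n := by exact_mod_cast hn3
    rw [← div_eq_mul_inv, div_le_iff₀ hnn, ← div_le_iff₀' (by positivity), div_eq_mul_inv]
    exact hN'.le.trans (by exact_mod_cast hn2)
  calc ∫⁻ ω, ‖(n : ℂ)⁻¹ * ∑ l' ∈ Finset.range l, X n l' ω -
      pw (a / (j + 1)) (j + 1) n l‖ₑ ∂(mu n)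
      ≤ ∫⁻ ω, (((ε / 2 : ℝ≥0) : ℝ≥0∞) + ∑ l' ∈ Finset.range n, (n : ℝ≥0∞)⁻¹ *
          ‖X n l' ω - pw a j n l'‖ₑ) ∂(mu n) := by
        refine lintegral_mono fun ω => ?_
        have : (n : ℂ)⁻¹ * ∑ l' ∈ Finset.range l, X n l' ω - pw (a / (j + 1)) (j + 1) n l =
            ((n : ℂ)⁻¹ * ∑ l' ∈ Finset.range l, pw a j n l' - pw (a / (j + 1)) (j + 1) n l) +
            (n : ℂ)⁻¹ * ∑ l' ∈ Finset.range l, (X n l' ω - pw a j n l') := by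
          rw [Finset.sum_sub_distrib]; ring
        rw [this]
        refine (enorm_add_le _ _).trans (add_le_add hdet ?_)
        rw [enorm_mul, hne, ← Finset.mul_sum]
        gcongr
        refine (enorm_sum_le _ _).trans ?_
        exact Finset.sum_le_sum_of_subset (Finset.range_mono hl)
    _ = ((ε / 2 : ℝ≥0) : ℝ≥0∞) + ∑ l' ∈ Finset.range n, (n : ℝ≥0∞)⁻¹ *
          ∫⁻ ω, ‖X n l' ω - pw a j n l'‖ₑ ∂(mu n) := by
        rw [lintegral_add_left measurable_const,
          lintegral_finsetSum _ fun i _ => (hX.2.2.1 n i).enorm.const_mul _]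
        congr 1
        · simp
        · exact Finset.sum_congr rfl fun i _ => lintegral_const_mul _ (hX.2.2.1 n i).enorm
    _ ≤ ((ε / 2 : ℝ≥0) : ℝ≥0∞) + ∑ l' ∈ Finset.range n, (n : ℝ≥0∞)⁻¹ * ((ε / 2 : ℝ≥0) : ℝ≥0∞) := by
        gcongr with i hi
        exact hN n hn1 i (by simpa using hi)
    _ = ((ε / 2 : ℝ≥0) : ℝ≥0∞) + ((ε / 2 : ℝ≥0) : ℝ≥0∞) := by
        rw [Finset.sum_const, Finset.card_range, nsmul_eq_mul, ← mul_assoc,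
          ENNReal.mul_inv_cancel hn0 (by simp), one_mul]
    _ = ε := by rw [← ENNReal.coe_add, add_halves]

lemma cc_succ (p : ℕ) : ((p : ℂ) + 1) ^ p / (p.factorial : ℂ) / (((p + 1 : ℕ) : ℂ) + 1) = cc (p + 1) := by
  have h1 : ((p : ℂ) + 1) ≠ 0 := by exact_mod_cast Nat.succ_ne_zero p
  have h2 : ((p : ℂ) + 1 + 1) ≠ 0 := by exact_mod_cast Nat.succ_ne_zero (p + 1)
  have h3 : (p.factorial : ℂ) ≠ 0 := by exact_mod_cast p.factorial_ne_zero
  rw [cc, Nat.factorial_succ, Nat.factorial_succ]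
  push_cast
  field_simp
  ring

lemma tt_close_of {p : ℕ} (h : Good (D p) (pw (((p : ℂ) + 1) ^ p / (p.factorial : ℂ)) (p + 1)))
    (ε : ℝ≥0) (hε : ε ≠ 0) :
    ∃ N, ∀ n, N ≤ n → ∀ l, l ≤ n →
      ∫⁻ ω, ‖tt (p + 1) n l ω - pw (cc (p + 1)) (p + 2) n l‖ₑ ∂(mu n) ≤ ε := by
  have := avg_null h ε hε
  rw [cc_succ] at this
  simpa only [tt_succ] using this

lemma Good_tt (k : ℕ) : Good (tt k) (pw (cc k) (k + 1)) := by
  induction k using Nat.strong_induction_on with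
  | _ k ih =>
    refine ⟨Bdd_tt k, Bdd_pw _ _, fun n l => (cont_tt k n l).measurable.sub measurable_const, ?_⟩
    cases k with
    | zero =>
      intro ε hε
      refine ⟨0, fun n _ l hl => ?_⟩
      simp [tt_zero hl.le, pw, cc]
    | succ p =>
      intro ε hε
      obtain ⟨N, hN⟩ := tt_close_of (Good_D p fun m hm => Good_c (ih m (by omega))) ε hε
      exact ⟨N, fun n hn l hl => hN n hn l hl.le⟩

lemma tt_full (p : ℕ) (ε : ℝ≥0) (hε : ε ≠ 0) :
    ∃ N, ∀ n, N ≤ n → ∫⁻ ω, ‖tt (p + 1) n n ω - cc (p + 1)‖ₑ ∂(mu n) ≤ ε := by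
  obtain ⟨N, hN⟩ := tt_close_of (Good_D p fun m _ => Good_c (Good_tt m)) ε hε
  refine ⟨max N 1, fun n hn => ?_⟩
  have := hN n (by omega) n le_rfl
  have hn0 : (n : ℂ) ≠ 0 := by simp; omega
  simpa [pw, div_self hn0] using this

lemma tendsto_tt (p : ℕ) : Filter.Tendsto (fun n => ∫ ω, tt (p + 1) n n ω ∂(mu n)) Filter.atTop
    (nhds (cc (p + 1))) := by
  rw [Metric.tendsto_atTop]
  intro ε hε
  obtain ⟨N, hN⟩ := tt_full p (ε / 2).toNNReal (by simp; linarith)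
  refine ⟨N, fun n hn => ?_⟩
  have h1 := hN n hn
  have hm : AEStronglyMeasurable (fun ω => tt (p + 1) n n ω - cc (p + 1)) (mu n) :=
    ((cont_tt (p + 1) n n).sub continuous_const).aestronglyMeasurable
  have hi : Integrable (fun ω => tt (p + 1) n n ω - cc (p + 1)) (mu n) :=
    ⟨hm, lt_of_le_of_lt h1 ENNReal.coe_lt_top⟩
  have hi2 : Integrable (fun ω => tt (p + 1) n n ω) (mu n) := by
    have := hi.add (integrable_const (cc (p + 1)))
    refine this.congr (Filter.Eventually.of_forall fun ω => ?_)
    simp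
  have h2 : ∫ ω, tt (p + 1) n n ω ∂(mu n) - cc (p + 1) =
      ∫ ω, (tt (p + 1) n n ω - cc (p + 1)) ∂(mu n) := by
    rw [integral_sub hi2 (integrable_const _)]; simp
  rw [dist_eq_norm, h2]
  have h3 : ENNReal.ofReal ‖∫ ω, (tt (p + 1) n n ω - cc (p + 1)) ∂(mu n)‖ ≤ ENNReal.ofReal (ε / 2) := by
    rw [ofReal_norm]
    exact (enorm_integral_le_lintegral_enorm _).trans h1
  rw [ENNReal.ofReal_le_ofReal_iff (by linarith)] at h3
  linarith

end main
end GTaux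

/-- For `T_n` with law `GT(n)`, the limit of `E[tr_n((T_n*T_n)^p)]` as `n → ∞` is
`p^p/(p+1)!`. -/
theorem stmt15 (p : ℕ) (hp : 1 ≤ p) :
    Filter.Tendsto
      (fun n : ℕ =>
        ∫ t : Fin n → Fin n → ℂ,
          (n : ℂ)⁻¹ * (((Matrix.of t)ᴴ * Matrix.of t) ^ p).trace ∂(GTlaw n))
      Filter.atTop (nhds ((p : ℂ) ^ p / ((p + 1).factorial : ℂ))) := by
  obtain ⟨p, rfl⟩ := Nat.exists_eq_add_of_le' hp
  have h := GTaux.tendsto_tt p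
  rw [GTaux.cc] at h
  refine h.congr fun n => ?_
  rw [GTaux.GTlaw_eq, integral_map]
  · refine integral_congr_ae (Filter.Eventually.of_forall fun ω => ?_)
    simp only
    rw [GTaux.Sm_full n ω _ (fun i j => rfl), GTaux.tt, GTaux.Am_succ]
  · refine Measurable.aemeasurable ?_
    refine measurable_pi_lambda _ fun i => measurable_pi_lambda _ fun j => ?_
    split_ifs
    · exact (measurable_pi_apply j).comp (measurable_pi_apply i)
    · exact measurable_const
  · refine Continuous.aestronglyMeasurable ?_
    exact continuous_const.mul (Continuous.matrix_trace
      (((continuous_id.matrix_conjTranspose).mul continuous_id).pow (p + 1)))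
end

section
/- Let μ be a compactly supported Borel probability measure on ℂ. For each n ≥ 1, let the joint law of (D_n, T_n) be given as follows: D_n = diag(d₁,…,d_n) is a diagonal random matrix whose diagonal entries are i.i.d. with law μ, T_n is a strictly upper triangular random matrix with law GT(n), and D_n and T_n are independent. Then for all p, q ∈ ℕ: if p ≠ q, then lim_{n→∞} E[tr_n((D_n·T_n)^p · D_n · D_n* · (T_n*·D_n*)^q)] = 0; and if p = q, then lim_{n→∞} E[tr_n((D_n·T_n)^p · D_n · D_n* · (T_n*·D_n*)^p)] = (∫_ℂ |z|² dμ(z))^{p+1}/(p+1)!. (In the language of the paper: for the limiting pair (D,T), the elements (DT)^p·D are pairwise orthogonal in L² and ‖(DT)^p·D‖₂² = ‖D‖₂^{2(p+1)}/(p+1)!.) -/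
open MeasureTheory ProbabilityTheory Matrix
open scoped ENNReal NNReal

/-- The expectation `E[tr_n((D_n T_n)^p · D_n · D_n* · (T_n* D_n*)^q)]`, where `D_n` is the
diagonal matrix with entries `d` and `T_n` the strictly upper triangular matrix `t`, with
`(d,t)` distributed according to `μ^{⊗n} ⊗ GT(n)`. -/
noncomputable def mixedMoment (μ : Measure ℂ) (n p q : ℕ) : ℂ :=
  ∫ x : (Fin n → ℂ) × (Fin n → Fin n → ℂ),
    (n : ℂ)⁻¹ *
      ((Matrix.diagonal x.1 * Matrix.of x.2) ^ p * Matrix.diagonal x.1 *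
        (Matrix.diagonal x.1)ᴴ * ((Matrix.of x.2)ᴴ * (Matrix.diagonal x.1)ᴴ) ^ q).trace
    ∂((Measure.pi fun _ : Fin n => μ).prod (GTlaw n))


section helpers

lemma aux_split {E : Type*} [MeasurableSpace E] [Inhabited E] {n : ℕ} (ν : Fin n → Measure E)
    [∀ i, IsProbabilityMeasure (ν i)] (i : Fin n) (f : E → ℂ) (g : (Fin n → E) → ℂ)
    (hg : ∀ ω e, g (Function.update ω i e) = g ω) :
    ∫ ω, f (ω i) * g ω ∂(Measure.pi ν) = (∫ e, f e ∂(ν i)) * ∫ ω, g ω ∂(Measure.pi ν) ∧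
    (Integrable f (ν i) → Integrable g (Measure.pi ν) →
      Integrable (fun ω => f (ω i) * g ω) (Measure.pi ν)) := by
  cases n with
  | zero => exact i.elim0
  | succ m =>
    have mp := (measurePreserving_piFinSuccAbove ν i).symm
    have hgi : ∀ (e : E) (ω' : Fin m → E),
        g (i.insertNth (α := fun _ => E) e ω') = g (i.insertNth (α := fun _ => E) default ω') := by
      intro e ω'
      rw [← hg (i.insertNth (α := fun _ => E) default ω') e, Fin.update_insertNth]
    have key : ∀ f : E → ℂ, ∫ ω, f (ω i) * g ω ∂(Measure.pi ν) = (∫ e, f e ∂(ν i)) *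
        ∫ ω', g (i.insertNth (α := fun _ => E) default ω')
          ∂(Measure.pi fun j => ν (i.succAbove j)) := by
      intro f
      rw [← mp.integral_comp', ← integral_prod_mul]
      congr 1
      ext x
      have : (MeasurableEquiv.piFinSuccAbove (fun _ => E) i).symm x
        = i.insertNth (α := fun _ => E) x.1 x.2 := rfl
      rw [this, hgi]
      simp
    constructor
    · have h1 := key (fun _ => 1)
      simp only [one_mul, integral_const, probReal_univ, one_smul] at h1
      rw [key f, h1]
    · intro hf hgI
      rw [← mp.integrable_comp_emb (MeasurableEquiv.measurableEmbedding _)] at hgI ⊢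
      have e1 : (g ∘ (MeasurableEquiv.piFinSuccAbove (fun _ => E) i).symm)
          = fun x : E × (Fin m → E) => g (i.insertNth (α := fun _ => E) default x.2) := by
        ext x
        exact hgi x.1 x.2
      rw [e1] at hgI
      have h2 : Integrable (fun ω' => g (i.insertNth (α := fun _ => E) default ω'))
          (Measure.pi fun j => ν (i.succAbove j)) := hgI.of_comp_snd (NeZero.ne _)
      have h3 := hf.mul_prod h2
      refine h3.congr (Filter.Eventually.of_forall fun x => ?_)
      have : (MeasurableEquiv.piFinSuccAbove (fun _ => E) i).symm x
        = i.insertNth (α := fun _ => E) x.1 x.2 := rfl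
      simp only [Function.comp, this, hgi x.1 x.2]
      simp

instance inst_s16 (v : ℝ≥0) : IsProbabilityMeasure (complexGaussian v) := by
  unfold complexGaussian
  exact Measure.isProbabilityMeasure_map (by fun_prop)

lemma cg_memLp (v : ℝ≥0) : MemLp (fun z : ℂ => z) 2 (complexGaussian v) := by
  unfold complexGaussian
  rw [memLp_map_measure_iff (by fun_prop) (by fun_prop)]
  have h1 : MemLp (fun x : ℝ => (x : ℂ)) 2 (gaussianReal 0 (v / 2)) :=
    (memLp_id_gaussianReal 2).ofReal
  have hf : MemLp (fun p : ℝ × ℝ => (p.1 : ℂ)) 2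
    ((gaussianReal 0 (v / 2)).prod (gaussianReal 0 (v / 2))) := h1.comp_fst _
  have hs : MemLp (fun p : ℝ × ℝ => (p.2 : ℂ)) 2
    ((gaussianReal 0 (v / 2)).prod (gaussianReal 0 (v / 2))) := h1.comp_snd _
  exact hf.add (hs.mul_const Complex.I)

lemma gr_sq (v : ℝ≥0) : ∫ x, x ^ 2 ∂(gaussianReal 0 v) = v := by
  have := variance_id_gaussianReal (μ := 0) (v := v)
  rw [variance_of_integral_eq_zero (by fun_prop) (by simp)] at this
  simpa using this

lemma cg_sq (v : ℝ≥0) : ∫ z, z * star z ∂(complexGaussian v) = (v : ℂ) := by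
  unfold complexGaussian
  rw [integral_map (by fun_prop) (by fun_prop)]
  have h1 : Integrable (fun x : ℝ => x ^ 2) (gaussianReal 0 (v / 2)) :=
    (memLp_id_gaussianReal 2).integrable_sq
  have e : ∀ p : ℝ × ℝ, ((p.1 : ℂ) + p.2 * Complex.I) * star ((p.1 : ℂ) + p.2 * Complex.I)
      = ((p.1 ^ 2 + p.2 ^ 2 : ℝ) : ℂ) := by
    intro p
    simp
    linear_combination (-(p.2 : ℂ)^2) * Complex.I_sq
  simp_rw [e]
  rw [integral_complex_ofReal, integral_add (h1.comp_fst _) (h1.comp_snd _),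
    integral_fun_fst (fun x : ℝ => x ^ 2), integral_fun_snd (fun x : ℝ => x ^ 2), gr_sq]
  simp



instance entryProb (v : ℝ≥0) (c : Prop) [Decidable c] :
    IsProbabilityMeasure (if c then complexGaussian v else Measure.dirac 0) := by
  split_ifs <;> infer_instance

noncomputable def entryRow {n : ℕ} (v : ℝ≥0) (i : Fin n) : Measure (Fin n → ℂ) :=
  Measure.pi fun j => if (i : ℕ) < (j : ℕ) then complexGaussian v else Measure.dirac 0

instance {n : ℕ} (v : ℝ≥0) (i : Fin n) : IsProbabilityMeasure (entryRow v i) := by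
  unfold entryRow; infer_instance

lemma entry_memLp {n : ℕ} (v : ℝ≥0) (i k : Fin n) :
    MemLp (fun t : Fin n → ℂ => t k) 2 (entryRow v i) := by
  have h : MemLp (fun z : ℂ => z) 2
      (if (i : ℕ) < (k : ℕ) then complexGaussian v else Measure.dirac 0) := by
    split_ifs
    · exact cg_memLp v
    · exact (memLp_const (0 : ℂ)).ae_eq (by
        rw [Filter.EventuallyEq, ae_dirac_iff (by measurability)])
  exact h.comp_measurePreserving (measurePreserving_eval _ k)

lemma entry_cov {n : ℕ} (v : ℝ≥0) (i k l : Fin n) (hk : i < k) :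
    ∫ t, t k * star (t l) ∂(entryRow v i) = if k = l then (v : ℂ) else 0 := by
  split_ifs with h
  · subst h
    unfold entryRow
    rw [integral_comp_eval (X := fun _ : Fin n => ℂ)
      (μ := fun j : Fin n => if (i : ℕ) < (j : ℕ) then complexGaussian v else Measure.dirac 0)
      (i := k) (f := fun z : ℂ => z * star z) (by fun_prop), if_pos (by exact hk), cg_sq]
  · unfold entryRow
    rw [(aux_split (fun j : Fin n => if (i : ℕ) < (j : ℕ) then complexGaussian v else Measure.dirac 0)
      k (fun z => z) (fun t => star (t l)) ?_).1, if_pos (by exact hk), cg_mean, zero_mul]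
    intro ω e
    rw [Function.update_of_ne (Ne.symm h)]

noncomputable def rowLaw {n : ℕ} (μ : Measure ℂ) (v : ℝ≥0) (i : Fin n) :
    Measure (ℂ × (Fin n → ℂ)) := μ.prod (entryRow v i)

instance {n : ℕ} (μ : Measure ℂ) [IsProbabilityMeasure μ] (v : ℝ≥0) (i : Fin n) :
    IsProbabilityMeasure (rowLaw μ v i) := by
  unfold rowLaw; infer_instance

noncomputable def chainX {n : ℕ} (ω : Fin n → ℂ × (Fin n → ℂ)) (j : Fin n) : ℕ → Fin n → ℂ
  | 0, i => if i = j then (ω i).1 else 0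
  | p + 1, i => ∑ k ∈ Finset.Ioi i, ((ω i).1 * (ω i).2 k) * chainX ω j p k

lemma chainX_congr {n : ℕ} (ω ω' : Fin n → ℂ × (Fin n → ℂ)) (j : Fin n) (p : ℕ) (i : Fin n)
    (h : ∀ l, i ≤ l → ω l = ω' l) : chainX ω j p i = chainX ω' j p i := by
  induction p generalizing i with
  | zero => simp [chainX, h i le_rfl]
  | succ p ih =>
    simp only [chainX]
    refine Finset.sum_congr rfl fun k hk => ?_
    rw [h i le_rfl, ih k fun l hl => h l ((Finset.mem_Ioi.1 hk).le.trans hl)]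

lemma chainX_update {n : ℕ} (ω : Fin n → ℂ × (Fin n → ℂ)) (j : Fin n) (p : ℕ) (i k : Fin n)
    (hk : i < k) (e) : chainX (Function.update ω i e) j p k = chainX ω j p k := by
  apply chainX_congr
  intro l hl
  rw [Function.update_of_ne (hk.trans_le hl).ne']

lemma chainX_zero {n : ℕ} (ω : Fin n → ℂ × (Fin n → ℂ)) (j : Fin n) (p : ℕ) (i : Fin n)
    (h : (j : ℕ) < i + p) : chainX ω j p i = 0 := by
  induction p generalizing i with
  | zero =>
    have : i ≠ j := by rintro rfl; simp at h
    simp [chainX, this]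
  | succ p ih =>
    simp only [chainX]
    refine Finset.sum_eq_zero fun k hk => ?_
    have hik : i < k := Finset.mem_Ioi.1 hk
    have : (i : ℕ) < k := hik
    rw [ih k (by omega), mul_zero]

lemma chainX_meas {n : ℕ} (j : Fin n) (p : ℕ) (i : Fin n) :
    Measurable (fun ω : Fin n → ℂ × (Fin n → ℂ) => chainX ω j p i) := by
  induction p generalizing i with
  | zero =>
    simp only [chainX]
    split_ifs <;> fun_prop
  | succ p ih =>
    simp only [chainX]
    refine Finset.measurable_sum _ fun k _ => ?_
    have := ih k
    fun_prop

section moments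

variable {n : ℕ} (μ : Measure ℂ) [IsProbabilityMeasure μ] (v : ℝ≥0)

lemma dt_memLp (hμ : MemLp (fun z : ℂ => z) 2 μ) (i k : Fin n) :
    MemLp (fun e : ℂ × (Fin n → ℂ) => e.1 * e.2 k) 2 (rowLaw μ v i) := by
  rw [memLp_two_iff_integrable_sq_norm (by fun_prop)]
  have h1 := (memLp_two_iff_integrable_sq_norm (by fun_prop)).1 hμ
  have h2 := (memLp_two_iff_integrable_sq_norm (entry_memLp v i k).1).1 (entry_memLp v i k)
  simp only [norm_mul, mul_pow]
  exact h1.mul_prod h2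

lemma chainX_memLp (hμ : MemLp (fun z : ℂ => z) 2 μ) (j : Fin n) (p : ℕ) (i : Fin n) :
    MemLp (fun ω => chainX ω j p i) 2 (Measure.pi (rowLaw (n := n) μ v)) := by
  induction p generalizing i with
  | zero =>
    simp only [chainX]
    split_ifs
    · have : MemLp (fun e : ℂ × (Fin n → ℂ) => e.1) 2 (rowLaw μ v i) := hμ.comp_fst _
      exact this.comp_measurePreserving (measurePreserving_eval _ i)
    · exact memLp_const 0
  | succ p ih =>
    simp only [chainX]
    refine memLp_finsetSum _ fun k hk => ?_
    have hm := chainX_meas j p k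
    rw [memLp_two_iff_integrable_sq_norm (by fun_prop)]
    have h1 := (memLp_two_iff_integrable_sq_norm (by fun_prop)).1 (dt_memLp μ v hμ i k)
    have h2 := (memLp_two_iff_integrable_sq_norm (by fun_prop)).1 (ih k)
    have h3 := (aux_split (rowLaw μ v) i (fun e => ((‖e.1 * e.2 k‖ ^ 2 : ℝ) : ℂ))
      (fun ω => ((‖chainX ω j p k‖ ^ 2 : ℝ) : ℂ)) (fun ω e => by
        rw [chainX_update _ _ _ _ _ (Finset.mem_Ioi.1 hk)])).2 h1.ofReal h2.ofReal
    have h4 := h3.re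
    refine h4.congr (Filter.Eventually.of_forall fun ω => ?_)
    simp only [← Complex.ofReal_mul]
    rw [norm_mul (_ * _), mul_pow]
    exact Complex.ofReal_re _

noncomputable def chainF (p q : ℕ) (i j : Fin n) : ℂ :=
  ∫ ω, chainX ω j p i * star (chainX ω j q i) ∂(Measure.pi (rowLaw (n := n) μ v))

lemma dt_cov (i k l : Fin n) (hk : i < k) :
    ∫ e, (e.1 * e.2 k) * star (e.1 * e.2 l) ∂(rowLaw μ v i)
      = (∫ z, z * star z ∂μ) * if k = l then (v : ℂ) else 0 := by
  rw [← entry_cov v i k l hk, ← integral_prod_mul]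
  unfold rowLaw
  congr 1
  ext e
  simp only [star_mul']
  ring

lemma chainF_succ (hμ : MemLp (fun z : ℂ => z) 2 μ) (p q : ℕ) (i j : Fin n) :
    chainF μ v (p + 1) (q + 1) i j
      = (∫ z, z * star z ∂μ) * v * ∑ k ∈ Finset.Ioi i, chainF μ v p q k j := by
  unfold chainF
  have e : ∀ ω : Fin n → ℂ × (Fin n → ℂ), chainX ω j (p+1) i * star (chainX ω j (q+1) i)
      = ∑ k ∈ Finset.Ioi i, ∑ l ∈ Finset.Ioi i,
        (((ω i).1 * (ω i).2 k) * star ((ω i).1 * (ω i).2 l)) *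
          (chainX ω j p k * star (chainX ω j q l)) := by
    intro ω
    simp only [chainX, star_sum, Finset.sum_mul_sum]
    refine Finset.sum_congr rfl fun k _ => Finset.sum_congr rfl fun l _ => ?_
    simp only [star_mul']
    ring
  have hs : ∀ k ∈ Finset.Ioi i, ∀ l ∈ Finset.Ioi i, _ := fun k hk l hl =>
    aux_split (rowLaw μ v) i (fun e => (e.1 * e.2 k) * star (e.1 * e.2 l))
      (fun ω => chainX ω j p k * star (chainX ω j q l)) (fun ω e => by
        rw [chainX_update _ _ _ _ _ (Finset.mem_Ioi.1 hk),
          chainX_update _ _ _ _ _ (Finset.mem_Ioi.1 hl)])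
  have hint : ∀ k ∈ Finset.Ioi i, ∀ l ∈ Finset.Ioi i, _ := fun k hk l hl =>
    (hs k hk l hl).2 ((dt_memLp μ v hμ i k).integrable_mul (dt_memLp μ v hμ i l).star)
      ((chainX_memLp μ v hμ j p k).integrable_mul (chainX_memLp μ v hμ j q l).star)
  simp_rw [e]
  rw [integral_finsetSum _ fun k hk => integrable_finsetSum _ fun l hl => hint k hk l hl,
    Finset.mul_sum]
  refine Finset.sum_congr rfl fun k hk => ?_
  rw [integral_finsetSum _ fun l hl => hint k hk l hl, Finset.sum_eq_single k]
  · rw [(hs k hk k hk).1, dt_cov _ _ _ _ _ (Finset.mem_Ioi.1 hk), if_pos rfl]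
  · intro l hl hlk
    rw [(hs k hk l hl).1, dt_cov _ _ _ _ _ (Finset.mem_Ioi.1 hk), if_neg hlk.symm]
    simp
  · exact fun h => absurd hk h

lemma chainF_ne (hμ : MemLp (fun z : ℂ => z) 2 μ) (p q : ℕ) (h : p ≠ q) (i j : Fin n) :
    chainF μ v p q i j = 0 := by
  induction p generalizing q i with
  | zero =>
    have : ∀ ω : Fin n → ℂ × (Fin n → ℂ), chainX ω j 0 i * star (chainX ω j q i) = 0 := by
      intro ω
      by_cases hij : i = j
      · subst hij
        rw [chainX_zero ω i q i (by omega)]; simp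
      · simp [chainX, hij]
    simp only [chainF, this, integral_zero]
  | succ p ih =>
    cases q with
    | zero =>
      have : ∀ ω : Fin n → ℂ × (Fin n → ℂ), chainX ω j (p+1) i * star (chainX ω j 0 i) = 0 := by
        intro ω
        by_cases hij : i = j
        · subst hij
          rw [chainX_zero ω i (p+1) i (by omega)]; simp
        · simp [chainX, hij]
      simp only [chainF, this, integral_zero]
    | succ q =>
      rw [chainF_succ μ v hμ, Finset.sum_eq_zero fun k _ => ih q (by omega) k, mul_zero]

lemma sum_choose_aux (n a p : ℕ) :
    ∑ k : Fin n, (if a ≤ (k : ℕ) then (n - 1 - k).choose p else 0) = (n - a).choose (p + 1) := by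
  induction n generalizing a with
  | zero => simp
  | succ n ih =>
    rw [Fin.sum_univ_succ]
    have h : ∀ k : Fin n, (if a ≤ ((Fin.succ k : Fin (n + 1)) : ℕ) then
        (n + 1 - 1 - ((Fin.succ k : Fin (n + 1)) : ℕ)).choose p else 0)
        = if a - 1 ≤ (k : ℕ) then (n - 1 - k).choose p else 0 := by
      intro k
      rw [Fin.val_succ, show n + 1 - 1 - ((k : ℕ) + 1) = n - 1 - k by omega]
      congr 1
      simp only [eq_iff_iff]
      omega
    simp_rw [h]
    rw [ih]
    cases a with
    | zero => simp [Nat.choose_succ_succ]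
    | succ b => simp

lemma chainF_sum (hμ : MemLp (fun z : ℂ => z) 2 μ) (p : ℕ) (i : Fin n) :
    ∑ j, chainF μ v p p i j
      = (∫ z, z * star z ∂μ) ^ (p + 1) * (v : ℂ) ^ p * ((n - 1 - i).choose p : ℕ) := by
  induction p generalizing i with
  | zero =>
    rw [Finset.sum_eq_single i]
    · have : ∫ e : ℂ × (Fin n → ℂ), e.1 * star e.1 ∂(rowLaw μ v i) = ∫ z, z * star z ∂μ := by
        unfold rowLaw
        rw [integral_fun_fst (fun z : ℂ => z * star z)]
        simp
      simp only [chainF, chainX, if_true]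
      rw [integral_comp_eval (X := fun _ : Fin n => ℂ × (Fin n → ℂ)) (μ := rowLaw μ v) (i := i)
        (f := fun e : ℂ × (Fin n → ℂ) => e.1 * star e.1) (by fun_prop), this]
      simp
    · intro j _ hj
      simp [chainF, chainX, hj.symm]
    · simp
  | succ p ih =>
    simp_rw [chainF_succ μ v hμ]
    rw [← Finset.mul_sum, Finset.sum_comm]
    simp_rw [ih]
    rw [← Finset.mul_sum, ← Nat.cast_sum]
    have h : ∑ k ∈ Finset.Ioi i, (n - 1 - (k : ℕ)).choose p = (n - 1 - i).choose (p + 1) := by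
      have h1 := sum_choose_aux n (i + 1) p
      rw [← Finset.sum_filter] at h1
      rw [show n - 1 - (i : ℕ) = n - (i + 1) by omega, ← h1]
      refine Finset.sum_congr ?_ fun _ _ => rfl
      ext k
      simp [Nat.succ_le_iff]
    rw [h]
    ring

lemma chainF_total (hμ : MemLp (fun z : ℂ => z) 2 μ) (p : ℕ) :
    ∑ i : Fin n, ∑ j, chainF μ v p p i j
      = (∫ z, z * star z ∂μ) ^ (p + 1) * (v : ℂ) ^ p * (n.choose (p + 1) : ℕ) := by
  simp_rw [chainF_sum μ v hμ]
  rw [← Finset.mul_sum, ← Nat.cast_sum]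
  have := sum_choose_aux n 0 p
  simp only [Nat.zero_le, if_true, Nat.sub_zero] at this
  rw [this]

end moments

lemma chainX_matrix {n : ℕ} (ω : Fin n → ℂ × (Fin n → ℂ))
    (h : ∀ i j : Fin n, ¬ i < j → (ω i).2 j = 0) (p : ℕ) (i j : Fin n) :
    ((Matrix.diagonal (fun i => (ω i).1) * Matrix.of (fun i => (ω i).2)) ^ p *
      Matrix.diagonal (fun i => (ω i).1)) i j = chainX ω j p i := by
  induction p generalizing i with
  | zero =>
    rw [pow_zero, Matrix.one_mul, Matrix.diagonal_apply]
    rfl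
  | succ p ih =>
    rw [pow_succ', Matrix.mul_assoc, Matrix.mul_apply]
    simp_rw [ih]
    simp only [chainX, Matrix.diagonal_mul, Matrix.of_apply]
    symm
    apply Finset.sum_subset (Finset.subset_univ _)
    intro k _ hk
    rw [h i k (by simpa using hk)]
    simp

lemma rowLaw_upper {n : ℕ} (μ : Measure ℂ) [IsProbabilityMeasure μ] (v : ℝ≥0) :
    ∀ᵐ ω ∂(Measure.pi (rowLaw (n := n) μ v)), ∀ i j : Fin n, ¬ i < j → (ω i).2 j = 0 := by
  rw [ae_all_iff]; intro i
  rw [ae_all_iff]; intro j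
  rw [Filter.eventually_imp_distrib_left]; intro hij
  have h1 : ∀ᵐ t ∂(entryRow v i), t j = 0 := by
    have : ∀ᵐ z ∂(if (i : ℕ) < (j : ℕ) then complexGaussian v else Measure.dirac 0), z = (0 : ℂ) := by
      rw [if_neg (by exact hij), ae_dirac_iff (by measurability)]
    exact (measurePreserving_eval (fun j : Fin n =>
      if (i : ℕ) < (j : ℕ) then complexGaussian v else Measure.dirac 0) j).quasiMeasurePreserving.ae this
  have h2 : ∀ᵐ e ∂(rowLaw μ v i), e.2 j = 0 :=
    Measure.quasiMeasurePreserving_snd.ae h1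
  exact (measurePreserving_eval _ i).quasiMeasurePreserving.ae h2

lemma mixedMoment_eq (μ : Measure ℂ) [IsProbabilityMeasure μ]
    (hμ : MemLp (fun z : ℂ => z) 2 μ) (n p q : ℕ) :
    mixedMoment μ n p q = (n : ℂ)⁻¹ * ∑ i : Fin n, ∑ j, chainF μ (n : ℝ≥0)⁻¹ p q i j := by
  unfold mixedMoment
  have mp := measurePreserving_arrowProdEquivProdArrow ℂ (Fin n → ℂ) (Fin n) (fun _ => μ)
    (fun i => entryRow (n : ℝ≥0)⁻¹ i)
  change ∫ x, _ ∂((Measure.pi fun _ : Fin n => μ).prod (Measure.pi fun i => entryRow (n : ℝ≥0)⁻¹ i)) = _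
  rw [← mp.integral_comp', integral_const_mul]
  congr 1
  have : ∀ᵐ ω ∂(Measure.pi (rowLaw (n := n) μ (n : ℝ≥0)⁻¹)),
      ((Matrix.diagonal (fun i => (ω i).1) * Matrix.of (fun i => (ω i).2)) ^ p *
        Matrix.diagonal (fun i => (ω i).1) * (Matrix.diagonal (fun i => (ω i).1))ᴴ *
        ((Matrix.of (fun i => (ω i).2))ᴴ * (Matrix.diagonal (fun i => (ω i).1))ᴴ) ^ q).trace
      = ∑ i, ∑ j, chainX ω j p i * star (chainX ω j q i) := by
    filter_upwards [rowLaw_upper (n := n) μ (n : ℝ≥0)⁻¹] with ω hω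
    set D := Matrix.diagonal (fun i => (ω i).1) with hD
    set T := Matrix.of (fun i => (ω i).2) with hT
    have e1 : ((D * T) ^ p * D * Dᴴ * (Tᴴ * Dᴴ) ^ q).trace
        = ∑ i, ∑ j, chainX ω j p i * star (chainX ω j q i) := by
      have : (D * T) ^ p * D * Dᴴ * (Tᴴ * Dᴴ) ^ q = ((D * T) ^ p * D) * ((D * T) ^ q * D)ᴴ := by
        rw [Matrix.conjTranspose_mul, Matrix.conjTranspose_pow, Matrix.conjTranspose_mul]
        simp only [Matrix.mul_assoc]
      rw [this]
      refine Finset.sum_congr rfl fun i _ => ?_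
      rw [Matrix.diag_apply, Matrix.mul_apply]
      refine Finset.sum_congr rfl fun j _ => ?_
      rw [Matrix.conjTranspose_apply, hD, hT, chainX_matrix ω hω, chainX_matrix ω hω]
    exact e1
  refine (integral_congr_ae this).trans ?_
  rw [integral_finsetSum]
  · refine Finset.sum_congr rfl fun i _ => ?_
    rw [integral_finsetSum]
    · rfl
    · exact fun j _ => (chainX_memLp μ _ hμ j p i).integrable_mul (chainX_memLp μ _ hμ j q i).star
  · exact fun i _ => integrable_finsetSum _ fun j _ =>
      (chainX_memLp μ _ hμ j p i).integrable_mul (chainX_memLp μ _ hμ j q i).star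

end helpers

/-- Orthogonality and norms of the elements `(DT)^p·D`: as `n → ∞`,
`E[tr_n((D_nT_n)^p D_n D_n* (T_n*D_n*)^q)]` tends to `0` if `p ≠ q`, and to
`(∫|z|²dμ)^{p+1}/(p+1)!` if `p = q`. -/
theorem stmt16 (μ : Measure ℂ) [IsProbabilityMeasure μ]
    (hμ : ∃ K : Set ℂ, IsCompact K ∧ μ Kᶜ = 0) (p q : ℕ) :
    (p ≠ q → Filter.Tendsto (fun n : ℕ => mixedMoment μ n p q) Filter.atTop (nhds 0)) ∧
    Filter.Tendsto (fun n : ℕ => mixedMoment μ n p p) Filter.atTop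
      (nhds (((∫ z : ℂ, ‖z‖ ^ 2 ∂μ : ℝ) : ℂ) ^ (p + 1) / ((p + 1).factorial : ℂ))) := by
  have hL : MemLp (fun z : ℂ => z) 2 μ := by
    obtain ⟨K, hK, hK0⟩ := hμ
    obtain ⟨C, hC⟩ := hK.isBounded.exists_norm_le
    refine MemLp.of_bound (by fun_prop) C ?_
    have : ∀ᵐ z ∂μ, z ∈ K := hK0
    filter_upwards [this] with z hz using hC z hz
  constructor
  · intro hpq
    have : (fun n : ℕ => mixedMoment μ n p q) = fun _ => 0 := by
      ext n
      rw [mixedMoment_eq μ hL]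
      simp [chainF_ne μ _ hL p q hpq]
    rw [this]
    exact tendsto_const_nhds
  · have hm : ∫ z, z * star z ∂μ = ((∫ z : ℂ, ‖z‖ ^ 2 ∂μ : ℝ) : ℂ) := by
      rw [← integral_complex_ofReal]
      congr 1
      ext z
      rw [Complex.star_def, Complex.mul_conj, Complex.normSq_eq_norm_sq]
    have hr : Filter.Tendsto (fun n : ℕ => (n : ℝ) * (n : ℝ)⁻¹) Filter.atTop (nhds 1) := by
      refine tendsto_const_nhds.congr' ?_
      filter_upwards [Filter.eventually_gt_atTop 0] with n hn
      field_simp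
    have h1 := tendsto_choose_mul_pow_atTop (p + 1) hr
    have h2 := ((Complex.continuous_ofReal.tendsto _).comp h1).const_mul
      ((((∫ z : ℂ, ‖z‖ ^ 2 ∂μ : ℝ) : ℂ)) ^ (p + 1))
    convert h2 using 2 with n
    · rw [mixedMoment_eq μ hL, chainF_total μ _ hL, hm]
      simp
      ring
    · simp
      ring
end
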